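/- arXiv:2201.09994 — 2 statements merged into one kernel-verified Lean document; each statement's English description precedes it below -/
import Mathlib

section
/- Let I ⊂ S = k[x_1,…,x_n] be a homogeneous ideal generated in degree d, of height c ≥ 2. Writing d̄_i for the maximal degree at step i of the minimal graded free resolution of S/I, one has the lower bound μ(I) ≥ (d̄_2 ⋯ d̄_c) / ((d̄_2 − d) ⋯ (d̄_c − d)). -/
/-- The free graded module with `b j` generators in degree `j` (i.e. `⊕_j A(-j)^{b j}`). -/
abbrev FreeMod (A : Type*) [CommRing A] (b : ℤ → ℕ) : Type _ :=
  ((j : ℤ) × Fin (b j)) →₀ A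

/-- A minimal graded free resolution of the module `M` over the (graded) commutative ring `A`,
where `hom m` is the set of homogeneous elements of degree `m` of `A`.  The data records the
graded Betti numbers `β i j` (the number of copies of `A(-j)` in homological degree `i`),
the differentials and the augmentation; the conditions say that the differentials are graded of
degree `0` (the entries of their matrices are homogeneous of the appropriate degree), that the
resolution is minimal (all entries have positive degree, equivalently lie in the irrelevant
maximal ideal), and that the complex is exact, resolving `M`. -/
structure MinGradedFreeRes (A : Type*) [CommRing A] (hom : ℕ → Set A)
    (M : Type*) [AddCommGroup M] [Module A M] where
  β : ℕ → ℤ → ℕ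
  finβ : ∀ i, (Function.support (β i)).Finite
  d : ∀ i, FreeMod A (β (i + 1)) →ₗ[A] FreeMod A (β i)
  aug : FreeMod A (β 0) →ₗ[A] M
  graded : ∀ (i : ℕ) (j : ℤ) (a : Fin (β (i + 1) j)) (j' : ℤ) (a' : Fin (β i j')),
      d i (Finsupp.single ⟨j, a⟩ 1) ⟨j', a'⟩ = 0 ∨
      ∃ m : ℕ, (m : ℤ) = j - j' ∧ d i (Finsupp.single ⟨j, a⟩ 1) ⟨j', a'⟩ ∈ hom m
  minimal : ∀ (i : ℕ) (j : ℤ) (a : Fin (β (i + 1) j)) (j' : ℤ) (a' : Fin (β i j')),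
      d i (Finsupp.single ⟨j, a⟩ 1) ⟨j', a'⟩ ≠ 0 → j' < j
  augSurj : Function.Surjective aug
  exact₀ : LinearMap.range (d 0) = LinearMap.ker aug
  exact : ∀ i, LinearMap.range (d (i + 1)) = LinearMap.ker (d i)

/-- The `i`-th total Betti number of a resolution. -/
noncomputable def MinGradedFreeRes.tB {A : Type*} [CommRing A] {hom : ℕ → Set A}
    {M : Type*} [AddCommGroup M] [Module A M]
    (res : MinGradedFreeRes A hom M) (i : ℕ) : ℕ :=
  ∑ j ∈ (res.finβ i).toFinset, res.β i j

/-- The height of an ideal: the infimum of the heights of the primes containing it. -/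
noncomputable def idealHeight {A : Type*} [CommRing A] (I : Ideal A) : ℕ∞ :=
  ⨅ (P : PrimeSpectrum A) (_ : I ≤ P.asIdeal), Order.height P


namespace MuLB

open Matrix

/-- `r` acts null-homotopically on the complex given by matrices. -/
def NullH {R : Type*} [CommRing R] {B : ℕ → Type*} [∀ i, Fintype (B i)] [∀ i, DecidableEq (B i)]
    (D : ∀ i, Matrix (B i) (B (i + 1)) R) (r : R) : Prop :=
  ∃ h : ∀ i, Matrix (B (i + 1)) (B i) R, D 0 * h 0 = r • (1 : Matrix (B 0) (B 0) R) ∧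
    ∀ i, D (i + 1) * h (i + 1) + h i * D i = r • (1 : Matrix (B (i + 1)) (B (i + 1)) R)

section
variable {R : Type*} [CommRing R] {B : ℕ → Type*} [∀ i, Fintype (B i)] [∀ i, DecidableEq (B i)]
    {D : ∀ i, Matrix (B i) (B (i + 1)) R}

theorem NullH.zero : NullH D 0 :=
  ⟨fun _ => 0, by simp, by simp⟩

theorem NullH.add {r s : R} (hr : NullH D r) (hs : NullH D s) : NullH D (r + s) := by
  obtain ⟨h, h0, h1⟩ := hr
  obtain ⟨g, g0, g1⟩ := hs
  refine ⟨fun i => h i + g i, ?_, fun i => ?_⟩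
  · rw [Matrix.mul_add, h0, g0, add_smul]
  · rw [Matrix.mul_add, Matrix.add_mul, add_smul, ← h1, ← g1]; abel

theorem NullH.mul {r : R} (s : R) (hr : NullH D r) : NullH D (s * r) := by
  obtain ⟨h, h0, h1⟩ := hr
  refine ⟨fun i => s • h i, ?_, fun i => ?_⟩
  · rw [Matrix.mul_smul, h0, smul_smul]
  · rw [Matrix.mul_smul, Matrix.smul_mul, ← smul_add, h1, smul_smul]

theorem NullH.map {R' : Type*} [CommRing R'] (φ : R →+* R') {r : R} (hr : NullH D r) :
    NullH (fun i => (D i).map φ) (φ r) := by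
  obtain ⟨h, h0, h1⟩ := hr
  refine ⟨fun i => (h i).map φ, ?_, fun i => ?_⟩
  · rw [← Matrix.map_mul, h0]
    ext a b
    by_cases hab : a = b <;> simp [hab]
  · have := congrArg (fun M => M.map φ) (h1 i)
    simp only [Matrix.map_add φ (map_add φ), Matrix.map_mul] at this
    rw [this]
    ext a b
    by_cases hab : a = b <;> simp [hab]

theorem NullH.of_map {R' : Type*} [CommRing R'] (φ : R →+* R') {I : Ideal R}
    (hI : ∀ f ∈ I, NullH D f) {r : R'} (hr : r ∈ I.map φ) :
    NullH (fun i => (D i).map φ) r := by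
  refine Submodule.span_induction ?_ NullH.zero (fun _ _ _ _ h h' => h.add h')
    (fun s _ _ h => h.mul s) hr
  rintro _ ⟨f, hf, rfl⟩
  exact (hI f hf).map φ

/-- boundaries in the dual complex -/
def Bd (D : ∀ i, Matrix (B i) (B (i + 1)) R) : ∀ i, (B i → R) → Prop
  | 0, v => v = 0
  | (i + 1), v => ∃ w : B i → R, v = w ᵥ* D i

theorem Bd.vecMul (hDD : ∀ i, D i * D (i + 1) = 0) : ∀ {i} {v : B i → R}, Bd D i v → v ᵥ* D i = 0
  | 0, v, h => by
      have : v = 0 := h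
      simp [this]
  | (i + 1), v, ⟨w, hw⟩ => by rw [hw, Matrix.vecMul_vecMul, hDD]; simp

theorem vecMul_mem {m n : Type*} [Fintype m] (J : Ideal R) (v : m → R) (M : Matrix m n R)
    (hv : ∀ b, v b ∈ J) (b : n) : (v ᵥ* M) b ∈ J := by
  simp only [Matrix.vecMul, dotProduct]
  exact J.sum_mem fun a _ => J.mul_mem_right _ (hv a)

theorem dual_exact (hDD : ∀ i, D i * D (i + 1) = 0) (c : ℕ) (x : ℕ → R) (J : ℕ → Ideal R)
    (hJ : ∀ r, J (r + 1) = J r ⊔ Ideal.span {x r})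
    (hreg : ∀ r < c, ∀ a, x r * a ∈ J r → a ∈ J r)
    (hx : ∀ r < c, NullH D (x r)) :
    ∀ i r, i + r < c → ∀ v : B i → R, (∀ b, (v ᵥ* D i) b ∈ J r) →
      ∃ w, Bd D i w ∧ ∀ b, v b - w b ∈ J r := by
  intro i
  induction i with
  | zero =>
    intro r hr v hv
    obtain ⟨h, h0, h1⟩ := hx r (by omega)
    refine ⟨0, rfl, fun b => ?_⟩
    have := vecMul_mem (J r) _ (h 0) hv b
    rw [Matrix.vecMul_vecMul, h0] at this
    apply hreg r (by omega)
    simpa [Matrix.vecMul_smul] using this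
  | succ i ih =>
    intro r hr v hv
    obtain ⟨h, h0, h1⟩ := hx r (by omega)
    have key : ∀ b, x r * v b - ((v ᵥ* h i) ᵥ* D i) b ∈ J r := by
      intro b
      have h2 := vecMul_mem (J r) _ (h (i+1)) hv b
      have h3 : v ᵥ* (D (i + 1) * h (i + 1) + h i * D i) = x r • v := by
        rw [h1, Matrix.vecMul_smul, Matrix.vecMul_one]
      rw [Matrix.vecMul_add, ← Matrix.vecMul_vecMul, ← Matrix.vecMul_vecMul] at h3
      have h4 := congrFun h3 b
      simp only [Pi.add_apply, Pi.smul_apply, smul_eq_mul] at h4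
      rw [← h4]
      simpa using h2
    have hle : J r ≤ J (r + 1) := by rw [hJ]; exact le_sup_left
    obtain ⟨w, hw, hw'⟩ := ih (r + 1) (by omega) (v ᵥ* h i) (by
      intro b
      have h2 := hle (key b)
      have h3 : x r * v b ∈ J (r + 1) := by
        rw [hJ]
        exact Ideal.mul_mem_right _ _ (Ideal.mem_sup_right (Ideal.mem_span_singleton_self _))
      have := (J (r+1)).sub_mem h3 h2
      simpa using this)
    have hch : ∀ b, ∃ y : R, (v ᵥ* h i) b - w b - x r * y ∈ J r := by
      intro b
      have h2 := hw' b
      rw [hJ, Submodule.mem_sup] at h2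
      obtain ⟨a, ha, z, hz, e⟩ := h2
      rw [Ideal.mem_span_singleton] at hz
      obtain ⟨y, rfl⟩ := hz
      refine ⟨y, ?_⟩
      rw [← e]; simpa using ha
    choose y hy using hch
    refine ⟨y ᵥ* D i, ⟨y, rfl⟩, fun b => ?_⟩
    apply hreg r (by omega)
    have h5 := vecMul_mem (J r) (fun b => (v ᵥ* h i) b - w b - x r * y b) (D i) hy b
    have h6 : (fun b => (v ᵥ* h i) b - w b - x r * y b) = v ᵥ* h i - w - x r • y := by
      ext; simp
    rw [h6, Matrix.sub_vecMul, Matrix.sub_vecMul, hw.vecMul hDD, Matrix.smul_vecMul] at h5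
    have := (J r).add_mem (key b) h5
    simp only [sub_zero, Pi.sub_apply, Pi.smul_apply, smul_eq_mul] at this
    convert this using 1
    ring

end

section res
variable {A : Type*} [CommRing A] {hom : ℕ → Set A} {M : Type*} [AddCommGroup M] [Module A M]
  (res : MinGradedFreeRes A hom M)

/-- index type of the basis of the `i`-th free module -/
abbrev BB (i : ℕ) : Type := (j : ℤ) × Fin (res.β i j)

instance (i : ℕ) : Finite (BB res i) := by
  have : Finite (Function.support (res.β i)) := res.finβ i
  let f : BB res i → (j : Function.support (res.β i)) × Fin (res.β i j) :=
    fun b => ⟨⟨b.1, fun h => (h ▸ b.2 : Fin 0).elim0⟩, b.2⟩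
  apply Finite.of_injective f
  rintro ⟨j, a⟩ ⟨j', a'⟩ h
  simp only [f, Sigma.mk.injEq] at h
  obtain ⟨h0, h⟩ := h
  have h0 : j = j' := congrArg Subtype.val h0
  subst h0
  simpa using h

noncomputable instance (i : ℕ) : Fintype (BB res i) := Fintype.ofFinite _

theorem card_BB (i : ℕ) : Fintype.card (BB res i) = res.tB i := by
  classical
  have e : BB res i ≃ (j : (res.finβ i).toFinset) × Fin (res.β i j) :=
    { toFun := fun b => ⟨⟨b.1, by
        simp only [Set.Finite.mem_toFinset, Function.mem_support]
        exact fun h => (h ▸ b.2 : Fin 0).elim0⟩, b.2⟩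
      invFun := fun b => ⟨b.1, b.2⟩
      left_inv := fun b => rfl
      right_inv := fun b => rfl }
  rw [Fintype.card_congr e, Fintype.card_sigma]
  simp only [Fintype.card_fin]
  exact Finset.sum_coe_sort (res.finβ i).toFinset (fun j => res.β i j)

/-- the matrix of the differential -/
noncomputable def DD (i : ℕ) : Matrix (BB res i) (BB res (i + 1)) A :=
  fun b' b => res.d i (Finsupp.single b 1) b'

theorem DD_eq (i : ℕ) : DD res i =
    LinearMap.toMatrix Finsupp.basisSingleOne Finsupp.basisSingleOne (res.d i) := by
  ext a b
  simp [DD, LinearMap.toMatrix_apply]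

theorem DD_mul (i : ℕ) : DD res i * DD res (i + 1) = 0 := by
  rw [DD_eq, DD_eq, ← LinearMap.toMatrix_comp]
  have : (res.d i) ∘ₗ (res.d (i + 1)) = 0 := by
    rw [← LinearMap.range_le_ker_iff, res.exact]
  rw [this]; simp

theorem exists_lift {P N : Type*} {ι : Type*} [AddCommGroup P] [AddCommGroup N] [Module A P]
    [Module A N] (g : P →ₗ[A] N) (f : (ι →₀ A) →ₗ[A] N)
    (h : LinearMap.range f ≤ LinearMap.range g) : ∃ l : (ι →₀ A) →ₗ[A] P, g ∘ₗ l = f := by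
  have h' : ∀ i, ∃ p, g p = f (Finsupp.single i 1) := fun i => h ⟨_, rfl⟩
  choose p hp using h'
  refine ⟨Finsupp.basisSingleOne.constr A p, ?_⟩
  apply Finsupp.basisSingleOne.ext
  intro i
  simp [hp, Module.Basis.constr_apply]

theorem exists_homotopy (f : A) (hf : ∀ m : M, f • m = 0) : NullH (DD res) f := by
  classical
  have step0 : ∃ h : FreeMod A (res.β 0) →ₗ[A] FreeMod A (res.β 1),
      res.d 0 ∘ₗ h = f • LinearMap.id := by
    apply exists_lift
    rw [res.exact₀]
    rintro _ ⟨v, rfl⟩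
    simp [hf]
  have step : ∀ i (h : FreeMod A (res.β i) →ₗ[A] FreeMod A (res.β (i + 1))),
      res.d i ∘ₗ h ∘ₗ res.d i = f • res.d i →
      ∃ h' : FreeMod A (res.β (i + 1)) →ₗ[A] FreeMod A (res.β (i + 1 + 1)),
        ∀ v, res.d (i + 1) (h' v) + h (res.d i v) = f • v := by
    intro i h hh
    suffices ∃ h' : FreeMod A (res.β (i + 1)) →ₗ[A] FreeMod A (res.β (i + 1 + 1)),
        res.d (i + 1) ∘ₗ h' = f • LinearMap.id - h ∘ₗ res.d i by
      obtain ⟨h', hh'⟩ := this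
      refine ⟨h', fun v => ?_⟩
      have := LinearMap.congr_fun hh' v
      simp only [LinearMap.comp_apply, LinearMap.smul_apply, LinearMap.sub_apply,
        LinearMap.id_apply] at this
      rw [this]; abel
    apply exists_lift
    rw [res.exact]
    rintro _ ⟨v, rfl⟩
    have := LinearMap.congr_fun hh v
    simp only [LinearMap.comp_apply, LinearMap.smul_apply] at this
    simp [this]
  have hdd : ∀ i, (res.d i) ∘ₗ (res.d (i + 1)) = 0 := fun i => by
    rw [← LinearMap.range_le_ker_iff, res.exact]
  choose! nx hnx using step
  obtain ⟨g0, hg0⟩ := step0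
  let h : ∀ i, FreeMod A (res.β i) →ₗ[A] FreeMod A (res.β (i + 1)) :=
    fun i => Nat.rec g0 (fun i g => nx i g) i
  have hinv : ∀ i, res.d i ∘ₗ h i ∘ₗ res.d i = f • res.d i := by
    intro i
    induction i with
    | zero =>
      change res.d 0 ∘ₗ g0 ∘ₗ res.d 0 = _
      rw [← LinearMap.comp_assoc, hg0]; rfl
    | succ i ih =>
      change res.d (i+1) ∘ₗ nx i (h i) ∘ₗ res.d (i+1) = _
      apply LinearMap.ext
      intro v
      have h1 := hnx i _ ih (res.d (i + 1) v)
      have h2 := LinearMap.congr_fun (hdd i) v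
      simp only [LinearMap.comp_apply, LinearMap.zero_apply] at h2
      rw [h2, map_zero, add_zero] at h1
      simpa using h1
  refine ⟨fun i => LinearMap.toMatrix Finsupp.basisSingleOne Finsupp.basisSingleOne (h i), ?_, ?_⟩
  · rw [DD_eq, ← LinearMap.toMatrix_comp]
    change LinearMap.toMatrix _ _ (res.d 0 ∘ₗ g0) = _
    rw [hg0, map_smul, LinearMap.toMatrix_id]
  · intro i
    rw [DD_eq, DD_eq, ← LinearMap.toMatrix_comp, ← LinearMap.toMatrix_comp, ← map_add]
    have : res.d (i+1) ∘ₗ h (i + 1) + h i ∘ₗ res.d i = f • LinearMap.id := by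
      apply LinearMap.ext
      intro v
      exact hnx i _ (hinv i) v
    rw [this, map_smul, LinearMap.toMatrix_id]

end res
end MuLB

namespace MuLB
open MvPolynomial

section geom
attribute [local instance] MvPolynomial.gradedAlgebra
variable {K : Type*} [Field K] {n : ℕ}

/-- the linear form with given coefficients -/
noncomputable def lf (y : Fin n → K) : MvPolynomial (Fin n) K := ∑ i, C (y i) * X i

/-- `lf` as a linear map -/
noncomputable def lfL : (Fin n → K) →ₗ[K] MvPolynomial (Fin n) K where
  toFun := lf
  map_add' := fun x y => by simp [lf, add_mul, Finset.sum_add_distrib]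
  map_smul' := fun a y => by
    simp [lf, Finset.smul_sum, MvPolynomial.smul_eq_C_mul, mul_assoc]

theorem lf_single (i : Fin n) : lf (Pi.single i (1 : K)) = X i := by
  simp [lf, Pi.single_apply, apply_ite, ite_mul]

theorem lf_hom (y : Fin n → K) : (lf y).IsHomogeneous 1 := by
  apply IsHomogeneous.sum
  intro i _
  simpa using (isHomogeneous_C (Fin n) (y i)).mul (isHomogeneous_X K i)

theorem exists_cut [Infinite K] (J : Ideal (MvPolynomial (Fin n) K)) (c : ℕ)
    (hJ : ∀ P : Ideal (MvPolynomial (Fin n) K), P.IsPrime → J ≤ P → (c : ℕ∞) ≤ P.height) (r : ℕ) :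
    ∃ s : Finset (Fin n → K), s.card ≤ r ∧ ∀ P : Ideal (MvPolynomial (Fin n) K), P.IsPrime →
      J ≤ P → (∀ y ∈ s, lf y ∈ P) → (∀ i, X i ∈ P) ∨ ((c + r : ℕ) : ℕ∞) ≤ P.height := by
  classical
  induction r with
  | zero => exact ⟨∅, by simp, fun P hP h _ => Or.inr (by simpa using hJ P hP h)⟩
  | succ r ih =>
    obtain ⟨s, hs, h⟩ := ih
    let Ir := J ⊔ Ideal.span (lf '' (s : Set (Fin n → K)))
    have hIr : ∀ P : Ideal (MvPolynomial (Fin n) K), Ir ≤ P ↔ J ≤ P ∧ ∀ y ∈ s, lf y ∈ P := by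
      intro P
      simp only [Ir, sup_le_iff, Ideal.span_le, Set.image_subset_iff]
      rfl
    have hfin : Ir.minimalPrimes.Finite := Ideal.finite_minimalPrimes_of_isNoetherianRing _ _
    have hfin' : {Q ∈ Ir.minimalPrimes | ¬ ∀ i, X i ∈ Q}.Finite := hfin.subset (Set.sep_subset _ _)
    let V : Ideal (MvPolynomial (Fin n) K) → Subspace K (Fin n → K) :=
      fun Q => (Q.restrictScalars K).comap lfL
    have hne := Subspace.biUnion_ne_univ_of_top_notMem (k := K) (E := Fin n → K)
      (s := hfin'.toFinset.image V) (by
        simp only [Finset.mem_image, Set.Finite.mem_toFinset, Set.mem_ofPred_eq, not_exists, not_and]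
        rintro Q ⟨_, hQ⟩ hV
        apply hQ
        intro i
        have : Pi.single i (1 : K) ∈ V Q := by rw [hV]; trivial
        have h2 : lf (Pi.single i (1 : K)) ∈ Q := this
        rwa [lf_single] at h2)
    obtain ⟨y, hy⟩ := (Set.ne_univ_iff_exists_notMem _).1 hne
    refine ⟨insert y s, (Finset.card_insert_le _ _).trans (by omega), ?_⟩
    intro P hP hJP hsP
    obtain ⟨Q, hQ, hQP⟩ := Ideal.exists_minimalPrimes_le
      ((hIr P).2 ⟨hJP, fun y hy => hsP y (Finset.mem_insert_of_mem hy)⟩)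
    have hQp : Q.IsPrime := hQ.1.1
    have hQI := (hIr Q).1 hQ.1.2
    by_cases hall : ∀ i, X i ∈ Q
    · exact Or.inl fun i => hQP (hall i)
    · right
      have h3 := (h Q hQp hQI.1 hQI.2).resolve_left hall
      have hyQ : lf y ∉ Q := by
        intro hyQ
        apply hy
        simp only [Finset.mem_image, Set.Finite.mem_toFinset, Set.mem_ofPred_eq, Set.mem_iUnion]
        exact ⟨V Q, ⟨Q, ⟨hQ, hall⟩, rfl⟩, hyQ⟩
      have hlt : Q < P := lt_of_le_of_ne hQP (by
        rintro rfl
        exact hyQ (hsP y (Finset.mem_insert_self _ _)))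
      have := Ideal.height_add_one_le_of_lt_of_isPrime hlt
      refine le_trans ?_ this
      have e : ((c + (r + 1) : ℕ) : ℕ∞) = ((c + r : ℕ) : ℕ∞) + 1 := by push_cast; ring
      rw [e]
      gcongr

/-- the irrelevant ideal -/
noncomputable def irr (K : Type*) [Field K] (n : ℕ) : Ideal (MvPolynomial (Fin n) K) :=
  Ideal.span (Set.range X)

theorem irr_eq : irr K n = RingHom.ker (constantCoeff : MvPolynomial (Fin n) K →+* K) := by
  ext f
  rw [irr, ← Set.image_univ, mem_ideal_span_X_image, RingHom.mem_ker, constantCoeff_eq]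
  constructor
  · intro h
    by_contra h0
    obtain ⟨i, _, hi⟩ := h 0 (mem_support_iff.2 h0)
    exact hi rfl
  · intro h m hm
    have : m ≠ 0 := by
      rintro rfl
      exact (mem_support_iff.1 hm) h
    obtain ⟨i, hi⟩ := Finsupp.ne_iff.1 this
    exact ⟨i, Set.mem_univ _, hi⟩

instance irr_prime : (irr K n).IsPrime := by
  rw [irr_eq]; exact RingHom.ker_isPrime _

theorem irr_height : (irr K n).height ≤ n := by
  classical
  have h : (irr K n) ∈ (Ideal.span ((Finset.univ.image (X : Fin n → MvPolynomial (Fin n) K) :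
      Finset _) : Set (MvPolynomial (Fin n) K))).minimalPrimes := by
    have : (Ideal.span ((Finset.univ.image (X : Fin n → MvPolynomial (Fin n) K) :
      Finset _) : Set (MvPolynomial (Fin n) K))) = irr K n := by
      rw [irr]; simp
    rw [this, Ideal.minimalPrimes_eq_subsingleton_self]; simp
  refine (Ideal.height_le_card_of_mem_minimalPrimes_span_finset h).trans ?_
  exact_mod_cast (Finset.card_image_le).trans (by simp)

theorem hom_le_irr (J : Ideal (MvPolynomial (Fin n) K)) (hJ : J ≠ ⊤)
    (hh : J.IsHomogeneous (homogeneousSubmodule (Fin n) K)) : J ≤ irr K n := by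
  intro f hf
  rw [irr_eq, RingHom.mem_ker]
  by_contra h
  apply hJ
  have h0 := hh 0 hf
  rw [Ideal.eq_top_iff_one]
  have h1 : C (constantCoeff f) ∈ J := by
    have e : ((DirectSum.decompose (homogeneousSubmodule (Fin n) K) f 0 : _) :
      MvPolynomial (Fin n) K) = C (constantCoeff f) := by
      exact (MvPolynomial.decomposition.decompose'_apply f 0).trans (by simp [constantCoeff_eq])
    rwa [e] at h0
  have := J.mul_mem_left (C (constantCoeff f)⁻¹) h1
  rwa [← C_mul, inv_mul_cancel₀ h, C_1] at this

theorem exists_cut' [Infinite K] (J : Ideal (MvPolynomial (Fin n) K)) (c : ℕ)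
    (hh : J.IsHomogeneous (homogeneousSubmodule (Fin n) K)) (hcn : c ≤ n)
    (hJ : ∀ P : Ideal (MvPolynomial (Fin n) K), P.IsPrime → J ≤ P → (c : ℕ∞) ≤ P.height) :
    ∃ s : Finset (Fin n → K), s.card ≤ n - c ∧ 
      ∀ i, X i ∈ (J ⊔ Ideal.span (lf '' (s : Set (Fin n → K)))).radical := by
  obtain ⟨s, hs, h⟩ := exists_cut J c hJ (n - c)
  refine ⟨s, hs, fun i => ?_⟩
  rw [Ideal.radical_eq_sInf, Submodule.mem_sInf]
  rintro P ⟨hP, hPp⟩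
  let P' := (Ideal.homogeneousCore (homogeneousSubmodule (Fin n) K) P).toIdeal
  have hP'p : P'.IsPrime := Ideal.IsPrime.homogeneousCore hPp
  have hP'h : P'.IsHomogeneous (homogeneousSubmodule (Fin n) K) :=
    (Ideal.homogeneousCore (homogeneousSubmodule (Fin n) K) P).isHomogeneous
  have hP'P : P' ≤ P := Ideal.toIdeal_homogeneousCore_le _ _
  have hIh : (J ⊔ Ideal.span (lf '' (s : Set (Fin n → K)))).IsHomogeneous
      (homogeneousSubmodule (Fin n) K) := by
    apply hh.sup
    apply Ideal.homogeneous_span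
    rintro _ ⟨y, _, rfl⟩
    exact ⟨1, lf_hom y⟩
  have hle : (J ⊔ Ideal.span (lf '' (s : Set (Fin n → K)))) ≤ P' := by
    have := Ideal.homogeneousCore_mono (homogeneousSubmodule (Fin n) K) hP
    have h2 := hIh.toIdeal_homogeneousCore_eq_self
    rw [← h2]; exact this
  rw [sup_le_iff, Ideal.span_le, Set.image_subset_iff] at hle
  rcases h P' hP'p hle.1 (fun y hy => hle.2 hy) with h1 | h1
  · exact hP'P (h1 i)
  · have h2 := hom_le_irr P' hP'p.ne_top hP'h
    rcases eq_or_lt_of_le h2 with h3 | h3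
    · apply hP'P
      rw [h3]
      exact Ideal.subset_span ⟨i, rfl⟩
    · exfalso
      have h4 := Ideal.height_add_one_le_of_lt_of_isPrime h3
      have h5 := (add_le_add_left h1 1).trans (h4.trans irr_height)
      rw [Nat.add_sub_cancel' hcn] at h5
      have h6 : n + 1 ≤ n := by exact_mod_cast h5
      omega

theorem exists_phi [Infinite K] (J : Ideal (MvPolynomial (Fin n) K)) (c : ℕ)
    (hh : J.IsHomogeneous (homogeneousSubmodule (Fin n) K)) (hcn : c ≤ n)
    (hJ : ∀ P : Ideal (MvPolynomial (Fin n) K), P.IsPrime → J ≤ P → (c : ℕ∞) ≤ P.height) :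
    ∃ p : Fin n → Fin c → K, ∀ l : Fin c, 
      X l ∈ (J.map (aeval (fun i => lf (p i)) :
        MvPolynomial (Fin n) K →ₐ[K] MvPolynomial (Fin c) K)).radical := by
  classical
  obtain ⟨s, hs, h⟩ := exists_cut' J c hh hcn hJ
  let E : (Fin n → K) →ₗ[K] (s → K) := LinearMap.pi fun y => 
    Fintype.linearCombination K (y : Fin n → K)
  have hfr : c ≤ Module.finrank K (LinearMap.ker E) := by
    have h1 := LinearMap.finrank_range_add_finrank_ker E
    have h2 := Submodule.finrank_le (LinearMap.range E)
    simp only [Module.finrank_fintype_fun_eq_card, Fintype.card_fin, Fintype.card_coe] at h1 h2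
    omega
  obtain ⟨q, hq⟩ := exists_linearIndependent_of_le_finrank hfr
  have hq' : LinearIndependent K (fun l => (q l : Fin n → K)) :=
    hq.map' (LinearMap.ker E).subtype (Submodule.ker_subtype _)
  obtain ⟨g, hg⟩ := LinearMap.exists_leftInverse_of_injective 
    (Fintype.linearCombination K (fun l => (q l : Fin n → K))) 
    (LinearMap.ker_eq_bot.2 (linearIndependent_iff_injective_fintypeLinearCombination.1 hq'))
  refine ⟨fun i l => (q l : Fin n → K) i, fun l => ?_⟩
  set φ := (aeval (fun i => lf (fun l => (q l : Fin n → K) i)) :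
        MvPolynomial (Fin n) K →ₐ[K] MvPolynomial (Fin c) K) with hφ
  have hφy : ∀ y : Fin n → K, φ (lf y) = lf (fun l => ∑ i, y i * (q l : Fin n → K) i) := by
    intro y
    simp only [hφ, lf, map_sum, map_mul, aeval_X, algHom_C, algebraMap_eq]
    simp only [Finset.mul_sum, Finset.sum_mul]
    rw [Finset.sum_comm]
    simp [mul_assoc]
  have hX : ∀ i, φ (X i) ∈ (J.map φ).radical := by
    intro i
    obtain ⟨N, hN⟩ := h i
    refine ⟨N, ?_⟩
    rw [← map_pow]
    have h1 := Ideal.mem_map_of_mem φ hN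
    rw [Ideal.map_sup, Ideal.map_span] at h1
    have h2 : Ideal.span (φ '' (lf '' (s : Set (Fin n → K)))) = ⊥ := by
      rw [Ideal.span_eq_bot]
      rintro _ ⟨_, ⟨y, hy, rfl⟩, rfl⟩
      rw [hφy]
      have : (fun l => ∑ i, y i * (q l : Fin n → K) i) = 0 := by
        ext l
        have h3 := (q l).2
        rw [LinearMap.mem_ker] at h3
        have h4 := congrFun h3 ⟨y, hy⟩
        simp only [E, LinearMap.pi_apply, Fintype.linearCombination_apply, smul_eq_mul] at h4
        simpa [mul_comm] using h4
      rw [this]; simp [lf]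
    rwa [h2, sup_bot_eq] at h1
  have hXl : X l = φ (lf (fun i => g (Pi.single i 1) l)) := by
    rw [hφy]
    rw [← lf_single]
    congr 1
    ext l'
    have h3 := LinearMap.congr_fun hg (Pi.single l' 1)
    have h4 := congrFun h3 l
    simp only [LinearMap.comp_apply, LinearMap.id_apply,
      Fintype.linearCombination_apply_single, one_smul] at h4
    have h5 : (q l' : Fin n → K) = ∑ i, (q l' : Fin n → K) i • Pi.single i (1 : K) := by
      ext j; simp [Pi.single_apply]
    rw [h5, map_sum] at h4
    simp only [map_smul, Finset.sum_apply, Pi.smul_apply, smul_eq_mul] at h4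
    rw [Finset.sum_congr rfl fun i _ => mul_comm _ _]
    rw [h4, Pi.single_apply, Pi.single_apply]
    simp [eq_comm]
  rw [hXl, lf, map_sum]
  apply Ideal.sum_mem
  intro i _
  rw [map_mul]
  exact Ideal.mul_mem_left _ _ (hX i)

attribute [local instance] MvPolynomial.algebraMvPolynomial

theorem exists_params (k : Type*) [Field k] (n : ℕ) (I : Ideal (MvPolynomial (Fin n) k)) (d : ℕ)
    (hgen : ∃ G : Set (MvPolynomial (Fin n) k),
      (∀ g ∈ G, MvPolynomial.IsHomogeneous g d) ∧ Ideal.span G = I)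
    (c : ℕ) (hht : idealHeight I = (c : ℕ∞)) :
    ∃ p : Fin n → Fin c → AlgebraicClosure k, ∀ l : Fin c,
      X l ∈ (I.map (aeval (fun i => lf (p i)) :
        MvPolynomial (Fin n) k →ₐ[k] MvPolynomial (Fin c) (AlgebraicClosure k))).radical := by
  classical
  have hprime : ∀ P : Ideal (MvPolynomial (Fin n) k), P.IsPrime → I ≤ P → (c : ℕ∞) ≤ P.height := by
    intro P hP hIP
    rw [← hht, idealHeight]
    refine (iInf₂_le (⟨P, hP⟩ : PrimeSpectrum _) hIP).trans ?_
    rw [← PrimeSpectrum.height_eq_orderHeight]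
  obtain ⟨G, hG, rfl⟩ := hgen
  have hne : Ideal.span G ≠ ⊤ := by
    intro h
    have : idealHeight (Ideal.span G) = ⊤ := by
      rw [idealHeight, h]
      simp only [iInf_eq_top]
      intro P hP
      exact absurd (top_le_iff.1 hP) P.2.ne_top
    rw [this] at hht
    exact ENat.natCast_ne_top c hht.symm
  have hcn : c ≤ n := by
    have h1 := hom_le_irr (Ideal.span G) hne (Ideal.homogeneous_span _ _ fun g hg => ⟨d, hG g hg⟩)
    have h2 := (hprime _ irr_prime h1).trans irr_height
    exact_mod_cast h2
  let K := AlgebraicClosure k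
  let ι := algebraMap (MvPolynomial (Fin n) k) (MvPolynomial (Fin n) K)
  have hflat : Module.Flat (MvPolynomial (Fin n) k) (MvPolynomial (Fin n) K) :=
    Module.Flat.isBaseChange k (MvPolynomial (Fin n) k) K (MvPolynomial (Fin n) K)
      (Algebra.IsPushout.out (R := k) (S := MvPolynomial (Fin n) k) (R' := K)
        (S' := MvPolynomial (Fin n) K))
  obtain ⟨p, hp⟩ := exists_phi (K := K) ((Ideal.span G).map ι) c (by
      rw [Ideal.map_span]
      apply Ideal.homogeneous_span
      rintro _ ⟨g, hg, rfl⟩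
      exact ⟨d, (hG g hg).map _⟩) hcn (by
      intro P hP hIP
      have h1 := hprime (P.under _) inferInstance (Ideal.map_le_iff_le_comap.1 hIP)
      have h2 := Ideal.height_eq_height_add_of_liesOver_of_hasGoingDown (P.under (MvPolynomial (Fin n) k)) P
      rw [h2]
      exact h1.trans le_self_add)
  refine ⟨p, fun l => ?_⟩
  have := hp l
  convert this using 2
  rw [Ideal.map_span, Ideal.map_span, Ideal.map_span, ← Set.image_comp]
  congr 1
  apply Set.image_congr
  intro g _
  simp only [ι, Function.comp_apply, algebraMap_def]
  exact (MvPolynomial.aeval_map_algebraMap _ _ _).symm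

end geom
end MuLB

namespace MuLB
open MvPolynomial Matrix

theorem hreg_pow {K : Type*} [Field K] {c : ℕ} (N r : ℕ) (hr : r < c)
    (a : MvPolynomial (Fin c) K)
    (h : X (⟨r, hr⟩ : Fin c) ^ N * a ∈ Ideal.span
      ((fun s => monomial s (1 : K)) '' {s | ∃ l : Fin c, l.val < r ∧ s = Finsupp.single l N})) :
    a ∈ Ideal.span
      ((fun s => monomial s (1 : K)) '' {s | ∃ l : Fin c, l.val < r ∧ s = Finsupp.single l N}) := by
  rw [mem_ideal_span_monomial_image] at h ⊢
  intro xi hxi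
  have h1 : Finsupp.single (⟨r, hr⟩ : Fin c) N + xi ∈ (X (⟨r, hr⟩ : Fin c) ^ N * a).support := by
    rw [mem_support_iff, X_pow_eq_monomial, coeff_monomial_mul, one_mul]
    exact mem_support_iff.1 hxi
  obtain ⟨_, ⟨l, hl, rfl⟩, hle⟩ := h _ h1
  refine ⟨_, ⟨l, hl, rfl⟩, ?_⟩
  intro j
  have h2 := hle j
  by_cases hj : l = j
  · subst hj
    have : (⟨r, hr⟩ : Fin c) ≠ l := by
      intro e; rw [← e] at hl; simp at hl
    simpa [Finsupp.single_apply, this] using h2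
  · simp [Finsupp.single_apply, hj]

theorem exists_next {k K : Type*} [Field k] [Field K] {n c : ℕ} (I : Ideal (MvPolynomial (Fin n) k))
    (res : MinGradedFreeRes (MvPolynomial (Fin n) k)
      (fun m => {f | MvPolynomial.IsHomogeneous f m})
      (MvPolynomial (Fin n) k ⧸ I))
    (φ : MvPolynomial (Fin n) k →+* MvPolynomial (Fin c) K)
    (hφ : ∀ f m, IsHomogeneous f m → IsHomogeneous (φ f) m)
    (hrad : ∀ l, X l ∈ (I.map φ).radical) (i : ℕ) (hi : i < c) (b : BB res i) :
    ∃ b'' : BB res (i + 1), b.1 < b''.1 := by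
  classical
  by_contra! hcon
  have hnull : ∀ f ∈ I, NullH (DD res) f := fun f hf => exists_homotopy res f (by
    intro m
    obtain ⟨g, rfl⟩ := Ideal.Quotient.mk_surjective m
    rw [← Ideal.Quotient.mk_eq_mk, ← Submodule.Quotient.mk_smul, Ideal.Quotient.mk_eq_mk,
      Ideal.Quotient.eq_zero_iff_mem]
    exact I.mul_mem_right _ hf)
  choose N hN using hrad
  let N' := ∑ l, N l
  have hN' : ∀ l, X l ^ N' ∈ I.map φ := fun l =>
    Ideal.pow_mem_of_pow_mem _ (hN l) (Finset.single_le_sum (f := N) (fun _ _ => Nat.zero_le _) (Finset.mem_univ l))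
  let x : ℕ → MvPolynomial (Fin c) K := fun r => if hr : r < c then X ⟨r, hr⟩ ^ N' else 0
  let J : ℕ → Ideal (MvPolynomial (Fin c) K) := fun r => Ideal.span
      ((fun s => monomial s (1 : K)) '' {s | ∃ l : Fin c, l.val < r ∧ s = Finsupp.single l N'})
  have hJ0 : J 0 = ⊥ := by
    simp [J]
  have hJ : ∀ r, J (r + 1) = J r ⊔ Ideal.span {x r} := by
    intro r
    apply le_antisymm
    · rw [Ideal.span_le]
      rintro _ ⟨_, ⟨l, hl, rfl⟩, rfl⟩
      rcases Nat.lt_succ_iff_lt_or_eq.1 hl with h | h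
      · exact Ideal.mem_sup_left (Ideal.subset_span ⟨_, ⟨l, h, rfl⟩, rfl⟩)
      · apply Ideal.mem_sup_right
        apply Ideal.subset_span
        subst h
        simp [x, X_pow_eq_monomial]
    · apply sup_le
      · apply Ideal.span_mono
        apply Set.image_mono
        rintro _ ⟨l, hl, rfl⟩
        exact ⟨l, by omega, rfl⟩
      · rw [Ideal.span_le, Set.singleton_subset_iff]
        by_cases hr : r < c
        · simp only [x, hr, dif_pos]
          exact Ideal.subset_span ⟨_, ⟨⟨r, hr⟩, by simp, rfl⟩, by simp [X_pow_eq_monomial]⟩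
        · simp [x, hr]
  have key := dual_exact (D := fun i => (DD res i).map φ) (fun i => by
      rw [← Matrix.map_mul, DD_mul]; ext; simp) c x J hJ
    (fun r hr a h => by
      simp only [x, hr, dif_pos] at h
      exact hreg_pow N' r hr a h)
    (fun r hr => by
      simp only [x, hr, dif_pos]
      exact NullH.of_map φ hnull (hN' _)) i 0 (by omega) (Pi.single b 1) (by
      intro b''
      rw [hJ0]
      simp only [Matrix.single_one_vecMul, Matrix.row_apply, Matrix.map_apply, Ideal.mem_bot]
      by_contra hne
      have : DD res i b b'' ≠ 0 := fun h => hne (by rw [h, map_zero])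
      exact absurd (res.minimal i b''.1 b''.2 b.1 b.2 this) (not_lt.2 (hcon b'')))
  obtain ⟨w, hw, hwb⟩ := key
  have hw1 : w b = 1 := by
    have := hwb b
    rw [hJ0, Ideal.mem_bot, sub_eq_zero] at this
    simpa using this.symm
  cases i with
  | zero =>
    have : w = 0 := hw
    simp [this] at hw1
  | succ i =>
    obtain ⟨y, rfl⟩ := hw
    have h2 := congrArg constantCoeff hw1
    simp only [Matrix.vecMul, dotProduct, map_sum, map_mul, map_one, Matrix.map_apply] at h2
    rw [Finset.sum_eq_zero] at h2
    · simp at h2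
    · intro b' _
      convert mul_zero _
      by_contra hne
      have hne' : DD res i b' b ≠ 0 := fun h => hne (by rw [h, map_zero, map_zero])
      have hlt := res.minimal i b.1 b.2 b'.1 b'.2 hne'
      rcases res.graded i b.1 b.2 b'.1 b'.2 with h | ⟨m, hm, hh⟩
      · exact hne' h
      · have h3 := hφ _ m hh
        apply hne
        rw [constantCoeff_eq]
        apply h3.coeff_eq_zero
        simp
        intro h; omega
end MuLB

namespace MuLB
open MvPolynomial Matrix

section laurent
variable {K : Type*} [Field K] {m : ℕ}

/-- Laurent polynomials in `m` variables -/
abbrev LL (K : Type*) [Field K] (m : ℕ) : Type _ := AddMonoidAlgebra K (Fin m → ℤ)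

/-- Laurent polynomials with given support -/
def Sp (K : Type*) [Field K] {m : ℕ} (s : Set (Fin m → ℤ)) : Submodule K (LL K m) where
  carrier := {f | ∀ α, f.coeff α ≠ 0 → α ∈ s}
  zero_mem' := by intro α h; simp at h
  add_mem' := by
    intro f g hf hg α h
    by_cases h1 : f.coeff α = 0
    · apply hg; intro h2; apply h; simp [h1, h2]
    · exact hf α h1
  smul_mem' := by
    intro a f hf α h
    apply hf; intro h2; apply h; simp [h2]

theorem mem_Sp {s : Set (Fin m → ℤ)} {f : LL K m} :
    f ∈ Sp K s ↔ ∀ α, f.coeff α ≠ 0 → α ∈ s := Iff.rfl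

theorem Sp_mul {s t r : Set (Fin m → ℤ)} (h : ∀ α ∈ s, ∀ β ∈ t, α + β ∈ r) {f g : LL K m}
    (hf : f ∈ Sp K s) (hg : g ∈ Sp K t) : f * g ∈ Sp K r := by
  classical
  intro α hα
  have := AddMonoidAlgebra.support_coeff_mul_subset (x := f) (y := g) (Finsupp.mem_support_iff.2 hα)
  obtain ⟨a, ha, b, hb, rfl⟩ := Finset.mem_add.1 this
  exact h a (hf a (Finsupp.mem_support_iff.1 ha)) b (hg b (Finsupp.mem_support_iff.1 hb))

theorem Sp_single {s : Set (Fin m → ℤ)} {α : Fin m → ℤ} (h : α ∈ s) (a : K) :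
    AddMonoidAlgebra.single α a ∈ Sp K s := by
  classical
  intro β hβ
  rw [AddMonoidAlgebra.coeff_single, Finsupp.single_apply] at hβ
  by_cases e : α = β
  · rwa [← e]
  · simp [e] at hβ

/-- allowed exponents -/
def Ex (P Q : Finset (Fin m)) (s : Fin m → ℤ) : Set (Fin m → ℤ) :=
  {α | (∀ l ∈ P, 0 ≤ α l) ∧ ∀ l ∈ Q, α l ≤ s l}

/-- the twisting unit -/
noncomputable def uq (K : Type*) [Field K] {m : ℕ} (Q : Finset (Fin m)) (s : ℤ) : LL K m :=
  AddMonoidAlgebra.single (fun l => if l ∈ Q then s else 0) 1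

theorem uq_add (Q : Finset (Fin m)) (s t : ℤ) : uq K Q (s + t) = uq K Q s * uq K Q t := by
  rw [uq, uq, uq, AddMonoidAlgebra.single_mul_single, one_mul]
  congr 1
  ext l; by_cases h : l ∈ Q <;> simp [h]

theorem uq_zero (Q : Finset (Fin m)) : uq K Q 0 = 1 := by
  rw [uq, AddMonoidAlgebra.one_def]
  congr 1
  ext l; simp

theorem uq_pow (Q : Finset (Fin m)) (s : ℕ) : uq K Q s = uq K Q 1 ^ s := by
  induction s with
  | zero => simp [uq_zero]
  | succ s ih => rw [pow_succ, ← ih, ← uq_add]; simp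

/-- the Laurent variable `u_l ^ s` -/
noncomputable def uv (K : Type*) [Field K] {m : ℕ} (l : Fin m) (s : ℤ) : LL K m :=
  AddMonoidAlgebra.single (Pi.single l s) 1

theorem uv_mul_neg (l : Fin m) : uv K l 1 * uv K l (-1) = 1 := by
  rw [uv, uv, AddMonoidAlgebra.single_mul_single, ← Pi.single_add]
  simp [AddMonoidAlgebra.one_def]

theorem uq_one_eq (Q : Finset (Fin m)) : uq K Q 1 = ∏ l, (if l ∈ Q then uv K l 1 else 1) := by
  classical
  rw [← Finset.prod_filter]
  have : ∀ T : Finset (Fin m), ∏ l ∈ T, uv K l 1 = uq K T 1 := by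
    intro T
    induction T using Finset.induction_on with
    | empty => simp [uq, AddMonoidAlgebra.one_def]; rfl
    | insert a T ha ih =>
      rw [Finset.prod_insert ha, ih, uv, uq, uq, AddMonoidAlgebra.single_mul_single, one_mul]
      congr 1
      ext l
      by_cases h : l = a
      · subst h; simp [ha]
      · simp [h]
  rw [this]
  congr 1
  ext; simp

/-- the substitution of variables -/
noncomputable def tau (K : Type*) [Field K] {m : ℕ} (Q : Finset (Fin m)) :
    MvPolynomial (Fin m) K →ₐ[K] LL K m :=
  aeval (fun l => uv K l (if l ∈ Q then -1 else 1))

theorem tau_mem (Q : Finset (Fin m)) (f : MvPolynomial (Fin m) K) :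
    tau K Q f ∈ Sp K {α | (∀ l, l ∉ Q → 0 ≤ α l) ∧ ∀ l ∈ Q, α l ≤ 0} := by
  classical
  induction f using MvPolynomial.induction_on with
  | C a =>
    rw [tau, aeval_C]
    exact Sp_single (by simp) a
  | add p q hp hq => rw [map_add]; exact Submodule.add_mem _ hp hq
  | mul_X p i hp =>
    rw [map_mul]
    refine Sp_mul (t := {α | (∀ l, l ∉ Q → 0 ≤ α l) ∧ ∀ l ∈ Q, α l ≤ 0}) ?_ hp ?_
    · rintro α ⟨h1, h2⟩ β ⟨h3, h4⟩
      exact ⟨fun l hl => add_nonneg (h1 l hl) (h3 l hl), fun l hl => add_nonpos (h2 l hl) (h4 l hl)⟩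
    · rw [tau, aeval_X]
      apply Sp_single
      constructor
      · intro l hl
        by_cases e : l = i
        · subst e; simp [hl]
        · simp [e]
      · intro l hl
        by_cases e : l = i
        · subst e; simp [hl]
        · simp [e]

theorem uq_tau_mem (P Q : Finset (Fin m)) (hPQ : Disjoint P Q) (s : ℤ)
    (f : MvPolynomial (Fin m) K) :
    uq K Q s * tau K Q f ∈ Sp K (Ex P Q (fun _ => s)) := by
  refine Sp_mul (s := {fun l => if l ∈ Q then s else 0}) ?_ (show uq K Q s ∈ _ from Sp_single (Set.mem_singleton _) (1 : K)) (tau_mem Q f)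
  rintro _ rfl β ⟨h1, h2⟩
  constructor
  · intro l hl
    have := Finset.disjoint_left.1 hPQ hl
    simp [this, h1 l this]
  · intro l hl
    simp [hl, h2 l hl]

/-- the product polynomial -/
noncomputable def FQ (K : Type*) [Field K] {m : ℕ} (Q : Finset (Fin m)) :
    Polynomial (MvPolynomial (Fin m) K) :=
  ∏ l, if l ∈ Q then (Polynomial.C (X l) + Polynomial.X) else (1 + Polynomial.C (X l) * Polynomial.X)

/-- the substitution by coefficients -/
noncomputable def psi (K : Type*) [Field K] {m : ℕ} (Q : Finset (Fin m)) :
    MvPolynomial (Fin (m + 1)) K →ₐ[K] MvPolynomial (Fin m) K :=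
  aeval (fun i => (FQ K Q).coeff i)

theorem aeval_scale {R σ : Type*} [CommRing R] [Algebra K R] (x y : σ → R) (w : R)
    (h : ∀ i, x i = w * y i) (f : MvPolynomial σ K) (s : ℕ) (hf : IsHomogeneous f s) :
    aeval x f = w ^ s * aeval y f := by
  rw [aeval_def, aeval_def, eval₂_eq, eval₂_eq, Finset.mul_sum]
  apply Finset.sum_congr rfl
  intro a ha
  have h1 := hf (mem_support_iff.1 ha)
  rw [Finset.prod_congr rfl (fun i _ => by rw [h, mul_pow]), Finset.prod_mul_distrib,
    Finset.prod_pow_eq_pow_sum]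
  have h2 : ∑ i ∈ a.support, a i = s := by
    rw [← h1, Finsupp.weight_apply]
    simp [Finsupp.sum]
  rw [h2]; ring

theorem tau_psi (Q : Finset (Fin m)) (f : MvPolynomial (Fin (m + 1)) K) (s : ℕ)
    (hf : IsHomogeneous f s) :
    tau K ∅ (psi K ∅ f) = uq K Q s * tau K Q (psi K Q f) := by
  have e : ∀ Q : Finset (Fin m), tau K Q (psi K Q f) =
      aeval (fun i : Fin (m + 1) => ((FQ K Q).map (tau K Q : _ →+* LL K m)).coeff i) f := by
    intro Q
    rw [psi, ← AlgHom.comp_apply, MvPolynomial.comp_aeval]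
    simp
  rw [e, e, uq_pow]
  apply aeval_scale _ _ _ _ _ _ hf
  intro i
  rw [← Polynomial.coeff_C_mul]
  congr 1
  rw [uq_one_eq, map_prod, FQ, FQ, Polynomial.map_prod, Polynomial.map_prod,
    ← Finset.prod_mul_distrib]
  apply Finset.prod_congr rfl
  intro l _
  by_cases h : l ∈ Q
  · have h1 : (Polynomial.C (uv K l 1) * Polynomial.C (uv K l (-1)) : Polynomial (LL K m)) = 1 := by
      rw [← map_mul, uv_mul_neg, map_one]
    simp [h, tau, mul_add, h1]
  · simp [h, tau]

theorem FQ_natDegree (Q : Finset (Fin m)) : (FQ K Q).natDegree ≤ m := by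
  rw [FQ]
  refine (Polynomial.natDegree_prod_le _ _).trans ?_
  refine (Finset.sum_le_card_nsmul _ _ 1 ?_).trans (by simp)
  intro l _
  split_ifs
  · compute_degree
  · compute_degree

theorem mem_of_rad {S R : Type*} [CommRing S] [CommRing R] (g : S →+* R) {J : Ideal S} (P : Ideal R)
    (hle : J.map g ≤ P) (hP : P.IsPrime) {x : S} (hx : x ∈ J.radical) : g x ∈ P := by
  obtain ⟨N, hN⟩ := hx
  have h1 := hle (Ideal.mem_map_of_mem g hN)
  rw [map_pow] at h1
  exact hP.mem_of_pow_mem _ h1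

theorem FQ_map_ne {R : Type*} [CommRing R] [IsDomain R] (Q : Finset (Fin m))
    (g : MvPolynomial (Fin m) K →+* R) : (FQ K Q).map g ≠ 0 := by
  rw [FQ, Polynomial.map_prod, Finset.prod_ne_zero_iff]
  intro l _ hl
  by_cases h : l ∈ Q
  · have := congrArg (fun p => Polynomial.coeff p 1) hl
    simp [h, Polynomial.coeff_C] at this
  · have := congrArg (fun p => Polynomial.coeff p 0) hl
    simp [h] at this

theorem psi_top {S : Type*} [CommRing S] (I : Ideal S) (φ : S →+* MvPolynomial (Fin (m + 1)) K)
    (hrad : ∀ l, X l ∈ (I.map φ).radical) (Q : Finset (Fin m)) :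
    I.map ((psi K Q : _ →+* MvPolynomial (Fin m) K).comp φ) = ⊤ := by
  by_contra hne
  obtain ⟨P, hP, hle⟩ := Ideal.exists_le_maximal _ hne
  rw [← Ideal.map_map] at hle
  have hX : ∀ l, psi K Q (X l) ∈ P := by
    intro l
    exact mem_of_rad _ _ hle hP.isPrime (hrad l)
  have h0 : (FQ K Q).map (Ideal.Quotient.mk P) = 0 := by
    ext i
    rw [Polynomial.coeff_map, Polynomial.coeff_zero, Ideal.Quotient.eq_zero_iff_mem]
    by_cases hi : i < m + 1
    · have := hX ⟨i, hi⟩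
      simpa [psi] using this
    · rw [Polynomial.coeff_eq_zero_of_natDegree_lt (lt_of_le_of_lt (FQ_natDegree Q) (by omega))]
      exact P.zero_mem
  have := hP.isPrime
  exact FQ_map_ne Q (Ideal.Quotient.mk P) h0

end laurent
end MuLB

namespace MuLB
open MvPolynomial Matrix

section mv
variable {K : Type*} [Field K] {m : ℕ}

/-- the truncated pieces -/
noncomputable def WW (K : Type*) [Field K] {m : ℕ} {B : Type*} (deg : B → ℤ) (e : Fin m → ℤ)
    (P Q : Finset (Fin m)) : Submodule K (B → LL K m) :=
  Submodule.pi Set.univ (fun b => Sp K (Ex P Q (fun l => e l - 1 - deg b)))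

theorem mem_WW {B : Type*} {deg : B → ℤ} {e : Fin m → ℤ}
    {P Q : Finset (Fin m)} {v : B → LL K m} :
    v ∈ WW K deg e P Q ↔ ∀ b, v b ∈ Sp K (Ex P Q (fun l => e l - 1 - deg b)) := by
  simp [WW, Submodule.mem_pi]

theorem mulVec_mem {B B' : Type*} [Fintype B] {deg : B → ℤ} {deg' : B' → ℤ} {e : Fin m → ℤ}
    {P Q : Finset (Fin m)} (M : Matrix B' B (LL K m))
    (hM : ∀ b' b, M b' b ∈ Sp K (Ex P Q (fun _ => deg b - deg' b')))
    {v : B → LL K m} (hv : v ∈ WW K deg e P Q) : M *ᵥ v ∈ WW K deg' e P Q := by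
  rw [mem_WW] at hv ⊢
  intro b'
  simp only [Matrix.mulVec, dotProduct]
  apply Submodule.sum_mem
  intro b _
  refine Sp_mul ?_ (hM b' b) (hv b)
  rintro α ⟨h1, h2⟩ β ⟨h3, h4⟩
  refine ⟨fun l hl => add_nonneg (h1 l hl) (h3 l hl), fun l hl => ?_⟩
  have := h2 l hl
  have := h4 l hl
  simp only [Pi.add_apply]
  linarith

theorem Sp_mono {s t : Set (Fin m → ℤ)} (h : s ⊆ t) : Sp K s ≤ Sp K t :=
  fun _ hf α hα => h (hf α hα)

theorem Sp_split {s : Set (Fin m → ℤ)} (p : Set (Fin m → ℤ)) {f : LL K m} (hf : f ∈ Sp K s) :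
    ∃ f1 ∈ Sp K (s ∩ p), ∃ f2 ∈ Sp K (s ∩ pᶜ), f1 + f2 = f := by
  classical
  refine ⟨.ofCoeff (f.coeff.filter (· ∈ p)), ?_, .ofCoeff (f.coeff.filter (fun x => ¬ x ∈ p)), ?_, ?_⟩
  · intro α hα
    by_cases h : α ∈ p
    · simp only [Finsupp.filter_apply, h, if_true] at hα
      exact ⟨hf _ hα, h⟩
    · simp [Finsupp.filter_apply, h] at hα
  · intro α hα
    by_cases h : α ∈ p
    · simp [Finsupp.filter_apply, h] at hα
    · simp only [Finsupp.filter_apply, h, not_false_eq_true, if_true] at hα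
      exact ⟨hf _ hα, h⟩
  · rw [← AddMonoidAlgebra.ofCoeff_add, Finsupp.filter_add_filter_not]

theorem WW_split {B : Type*} {deg : B → ℤ} {e : Fin m → ℤ}
    {P Q : Finset (Fin m)} (l : Fin m) (hdeg : ∀ b, deg b ≤ e l) {v : B → LL K m}
    (hv : v ∈ WW K deg e P Q) :
    ∃ v1 ∈ WW K deg e (insert l P) Q, ∃ v2 ∈ WW K deg e P (insert l Q), v1 + v2 = v := by
  rw [mem_WW] at hv
  choose f1 h1 f2 h2 h using fun b => Sp_split {α | 0 ≤ α l} (hv b)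
  refine ⟨f1, ?_, f2, ?_, funext h⟩
  · rw [mem_WW]
    intro b
    refine Sp_mono ?_ (h1 b)
    rintro α ⟨⟨h3, h4⟩, h5⟩
    refine ⟨?_, h4⟩
    intro l' hl'
    rcases Finset.mem_insert.1 hl' with rfl | h6
    · exact h5
    · exact h3 l' h6
  · rw [mem_WW]
    intro b
    refine Sp_mono ?_ (h2 b)
    rintro α ⟨⟨h3, h4⟩, h5⟩
    refine ⟨h3, ?_⟩
    intro l' hl'
    rcases Finset.mem_insert.1 hl' with rfl | h6
    · have := hdeg b
      simp only [Set.mem_compl_iff, Set.mem_ofPred_eq, not_le] at h5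
      simp only
      omega
    · exact h4 l' h6

theorem WW_mono {B : Type*} {deg : B → ℤ} {e : Fin m → ℤ}
    {P Q P' Q' : Finset (Fin m)} (hP : P ⊆ P') (hQ : Q ⊆ Q') :
    WW K deg e P' Q' ≤ WW K deg e P Q := by
  intro v hv
  rw [mem_WW] at hv ⊢
  intro b
  refine Sp_mono ?_ (hv b)
  rintro α ⟨h3, h4⟩
  exact ⟨fun l hl => h3 l (hP hl), fun l hl => h4 l (hQ hl)⟩

theorem WW_inf {B : Type*} {deg : B → ℤ} {e : Fin m → ℤ}
    {P Q : Finset (Fin m)} (l : Fin m) {v : B → LL K m}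
    (h1 : v ∈ WW K deg e (insert l P) Q) (h2 : v ∈ WW K deg e P (insert l Q)) :
    v ∈ WW K deg e (insert l P) (insert l Q) := by
  rw [mem_WW] at h1 h2 ⊢
  intro b α hα
  exact ⟨(h1 b α hα).1, (h2 b α hα).2⟩

section cplx
variable {B : ℕ → Type*} [∀ i, Fintype (B i)]

/-- cycles -/
def Cyc (D : ∀ i, Matrix (B i) (B (i + 1)) (LL K m)) : ∀ i, (B i → LL K m) → Prop
  | 0, _ => True
  | (i + 1), z => D i *ᵥ z = 0

/-- exactness of a subcomplex at one spot -/
def ExAt (D : ∀ i, Matrix (B i) (B (i + 1)) (LL K m)) (W : ∀ i, Submodule K (B i → LL K m))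
    (i : ℕ) : Prop :=
  ∀ z ∈ W i, Cyc D i z → ∃ a ∈ W (i + 1), D i *ᵥ a = z

theorem mv_step (D : ∀ i, Matrix (B i) (B (i + 1)) (LL K m)) (hDD : ∀ i, D i * D (i + 1) = 0)
    (deg : ∀ i, B i → ℤ) (e : Fin m → ℤ)
    (hpres : ∀ P Q i v, v ∈ WW K (deg (i + 1)) e P Q → D i *ᵥ v ∈ WW K (deg i) e P Q)
    (P Q : Finset (Fin m)) (l : Fin m) (i : ℕ) (hdeg : ∀ b, deg (i + 2) b ≤ e l)
    (hA : ExAt D (fun i => WW K (deg i) e (insert l P) Q) i)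
    (hB : ExAt D (fun i => WW K (deg i) e P (insert l Q)) i)
    (hC : ExAt D (fun i => WW K (deg i) e P Q) (i + 1)) :
    ExAt D (fun i => WW K (deg i) e (insert l P) (insert l Q)) i := by
  intro z hz hcyc
  obtain ⟨a, ha, haz⟩ := hA z (WW_mono (Finset.Subset.refl _) (Finset.subset_insert _ _) hz) hcyc
  obtain ⟨b, hb, hbz⟩ := hB z (WW_mono (Finset.subset_insert _ _) (Finset.Subset.refl _) hz) hcyc
  obtain ⟨w, hw, hwz⟩ := hC (a - b) (Submodule.sub_mem _
    (WW_mono (Finset.subset_insert _ _) (Finset.Subset.refl _) ha)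
    (WW_mono (Finset.Subset.refl _) (Finset.subset_insert _ _) hb))
    (by change D i *ᵥ (a - b) = 0; rw [Matrix.mulVec_sub, haz, hbz, sub_self])
  obtain ⟨w1, hw1, w2, hw2, rfl⟩ := WW_split l hdeg hw
  rw [Matrix.mulVec_add] at hwz
  refine ⟨a - D (i + 1) *ᵥ w1, WW_inf l (Submodule.sub_mem _ ha (hpres _ _ _ _ hw1)) ?_, ?_⟩
  · have : a - D (i + 1) *ᵥ w1 = b + D (i + 1) *ᵥ w2 := by
      rw [sub_eq_iff_eq_add, add_assoc, add_comm (D (i + 1) *ᵥ w2), hwz]; abel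
    rw [this]
    exact Submodule.add_mem _ hb (hpres _ _ _ _ hw2)
  · rw [Matrix.mulVec_sub, haz, Matrix.mulVec_mulVec, hDD]; simp

theorem mv_all (D : ∀ i, Matrix (B i) (B (i + 1)) (LL K m)) (hDD : ∀ i, D i * D (i + 1) = 0)
    (deg : ∀ i, B i → ℤ) (e : Fin m → ℤ)
    (hpres : ∀ P Q i v, v ∈ WW K (deg (i + 1)) e P Q → D i *ᵥ v ∈ WW K (deg i) e P Q)
    (hdeg : ∀ (t : Fin m) i, i ≤ t.val + 2 → ∀ b, deg i b ≤ e t)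
    (hex : ∀ P Q, Disjoint P Q → ∀ i, ExAt D (fun i => WW K (deg i) e P Q) i) :
    ExAt D (fun i => WW K (deg i) e Finset.univ Finset.univ) 0 := by
  classical
  have key : ∀ s t, s + t = m → ∀ P Q : Finset (Fin m), (∀ l ∈ P, l ∈ Q → t ≤ l.val) →
      ∀ i ≤ t, ExAt D (fun i => WW K (deg i) e P Q) i := by
    intro s
    induction s with
    | zero =>
      intro t ht P Q hPQ i _
      apply hex
      rw [Finset.disjoint_left]
      intro l h1 h2
      have := hPQ l h1 h2
      omega
    | succ s ih =>
      intro t ht P Q hPQ i hi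
      have htm : t < m := by omega
      let l : Fin m := ⟨t, htm⟩
      by_cases hl : l ∈ P ∧ l ∈ Q
      · have e1 : insert l (P.erase l) = P := Finset.insert_erase hl.1
        have e2 : insert l (Q.erase l) = Q := Finset.insert_erase hl.2
        have hne : ∀ l' : Fin m, l' ≠ l → t ≤ l'.val → t + 1 ≤ l'.val := by
          intro l' h1 h2
          have : l'.val ≠ t := fun h => h1 (Fin.ext h)
          omega
        have := mv_step D hDD deg e hpres (P.erase l) (Q.erase l) l i
          (hdeg l _ (by simp only [l]; omega))
          (ih (t + 1) (by omega) _ _ (by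
            intro l' h1 h2
            rw [e1] at h1
            exact hne l' (Finset.ne_of_mem_erase h2) (hPQ _ h1 (Finset.mem_of_mem_erase h2))) i (by omega))
          (ih (t + 1) (by omega) _ _ (by
            intro l' h1 h2
            rw [e2] at h2
            exact hne l' (Finset.ne_of_mem_erase h1) (hPQ _ (Finset.mem_of_mem_erase h1) h2)) i (by omega))
          (ih (t + 1) (by omega) _ _ (by
            intro l' h1 h2
            exact hne l' (Finset.ne_of_mem_erase h1)
              (hPQ _ (Finset.mem_of_mem_erase h1) (Finset.mem_of_mem_erase h2))) (i + 1) (by omega))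
        rwa [e1, e2] at this
      · apply ih (t + 1) (by omega) P Q _ i (by omega)
        intro l' h1 h2
        have h3 := hPQ l' h1 h2
        have : l'.val ≠ t := by
          intro h
          have : l' = l := Fin.ext h
          subst this
          exact hl ⟨h1, h2⟩
        omega
  exact key m 0 (by omega) _ _ (fun _ _ _ => Nat.zero_le _) 0 le_rfl

theorem surj [∀ i, DecidableEq (B i)] (D : ∀ i, Matrix (B i) (B (i + 1)) (MvPolynomial (Fin (m + 1)) K))
    (hDD : ∀ i, D i * D (i + 1) = 0) (deg : ∀ i, B i → ℤ) (e : Fin m → ℤ)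
    (hhom : ∀ i b' b, D i b' b = 0 ∨ ∃ s : ℕ, (s : ℤ) = deg (i + 1) b - deg i b' ∧
      IsHomogeneous (D i b' b) s)
    (hnull : ∀ Q : Finset (Fin m), NullH (fun i => (D i).map (psi K Q)) 1)
    (hdeg : ∀ (t : Fin m) i, i ≤ t.val + 2 → ∀ b, deg i b ≤ e t) :
    ∀ z ∈ WW K (deg 0) e Finset.univ Finset.univ,
      ∃ a ∈ WW K (deg 1) e Finset.univ Finset.univ,
        ((D 0).map (fun f => tau K ∅ (psi K ∅ f))) *ᵥ a = z := by
  classical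
  let D' : ∀ i, Matrix (B i) (B (i + 1)) (LL K m) :=
    fun i => (D i).map ((tau K ∅).comp (psi K ∅))
  have hQ : ∀ (Q : Finset (Fin m)) i b' b, D' i b' b =
      uq K Q (deg (i + 1) b - deg i b') * tau K Q (psi K Q (D i b' b)) := by
    intro Q i b' b
    rcases hhom i b' b with h | ⟨s, hs, h⟩
    · simp [D', h]
    · rw [← hs]
      exact tau_psi Q _ s h
  have hDD' : ∀ i, D' i * D' (i + 1) = 0 := by
    intro i
    simp only [D']
    rw [← Matrix.map_mul, hDD]; ext; simp
  have hmem : ∀ P Q i b' b, D' i b' b ∈ Sp K (Ex P Q (fun _ => deg (i + 1) b - deg i b')) := by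
    intro P Q i b' b
    have h1 := hQ ∅ i b' b ▸ uq_tau_mem (K := K) Finset.univ ∅ (by simp) (deg (i + 1) b - deg i b') (psi K ∅ (D i b' b))
    have h2 := hQ Finset.univ i b' b ▸ uq_tau_mem (K := K) ∅ Finset.univ (by simp) (deg (i + 1) b - deg i b') (psi K Finset.univ (D i b' b))
    intro α hα
    exact ⟨fun l _ => (h1 α hα).1 l (Finset.mem_univ _), fun l _ => (h2 α hα).2 l (Finset.mem_univ _)⟩
  have hpres : ∀ P Q i v, v ∈ WW K (deg (i + 1)) e P Q → D' i *ᵥ v ∈ WW K (deg i) e P Q :=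
    fun P Q i v hv => mulVec_mem _ (hmem P Q i) hv
  have main := mv_all D' hDD' deg e hpres hdeg (by
    intro P Q hPQ
    obtain ⟨h, h0, h1⟩ := hnull Q
    let H : ∀ i, Matrix (B (i + 1)) (B i) (LL K m) := fun i => Matrix.of fun b' b =>
      uq K Q (deg i b - deg (i + 1) b') * tau K Q (h i b' b)
    have hH : ∀ i v, v ∈ WW K (deg i) e P Q → H i *ᵥ v ∈ WW K (deg (i + 1)) e P Q :=
      fun i v hv => mulVec_mem _ (fun b' b => uq_tau_mem P Q hPQ _ _) hv
    have hconj : ∀ i b b', (D' i * H i) b b' = uq K Q (deg i b' - deg i b) *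
        tau K Q (((D i).map (psi K Q) * h i) b b') := by
      intro i b b'
      rw [Matrix.mul_apply, Matrix.mul_apply, map_sum, Finset.mul_sum]
      apply Finset.sum_congr rfl
      intro x _
      rw [hQ Q]
      simp only [H, Matrix.of_apply, map_mul, Matrix.map_apply]
      have : deg i b' - deg i b = (deg (i + 1) x - deg i b) + (deg i b' - deg (i + 1) x) := by ring
      rw [this, uq_add]; ring
    have hconj' : ∀ i b b', (H i * D' i) b b' = uq K Q (deg (i + 1) b' - deg (i + 1) b) *
        tau K Q ((h i * (D i).map (psi K Q)) b b') := by
      intro i b b'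
      rw [Matrix.mul_apply, Matrix.mul_apply, map_sum, Finset.mul_sum]
      apply Finset.sum_congr rfl
      intro x _
      rw [hQ Q]
      simp only [H, Matrix.of_apply, map_mul, Matrix.map_apply]
      have : deg (i + 1) b' - deg (i + 1) b = (deg i x - deg (i + 1) b) + (deg (i + 1) b' - deg i x) := by ring
      rw [this, uq_add]; ring
    have hone : ∀ i (b b' : B i), uq K Q (deg i b' - deg i b) *
        tau K Q (((1 : MvPolynomial (Fin m) K) • (1 : Matrix (B i) (B i) (MvPolynomial (Fin m) K))) b b') = (1 : Matrix (B i) (B i) (LL K m)) b b' := by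
      intro i b b'
      rw [one_smul]
      by_cases hb : b = b'
      · subst hb; simp [uq_zero]
      · simp [hb]
    have H0 : D' 0 * H 0 = 1 := by
      ext1 b b'
      rw [hconj, h0, hone]
    have H1 : ∀ i, D' (i + 1) * H (i + 1) + H i * D' i = 1 := by
      intro i
      ext1 b b'
      rw [Matrix.add_apply, hconj, hconj', ← mul_add, ← map_add, ← Matrix.add_apply, h1, hone]
    intro i z hz hc
    refine ⟨H i *ᵥ z, hH i z hz, ?_⟩
    cases i with
    | zero => rw [Matrix.mulVec_mulVec, H0, Matrix.one_mulVec]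
    | succ i =>
      have hc : D' i *ᵥ z = 0 := hc
      have := congrArg (fun M => M *ᵥ z) (H1 i)
      simp only [Matrix.add_mulVec, ← Matrix.mulVec_mulVec, hc, Matrix.mulVec_zero, add_zero,
        Matrix.one_mulVec] at this
      exact this)
  intro z hz
  exact main z hz trivial

end cplx
end mv
end MuLB

namespace MuLB
open MvPolynomial Matrix

section dim
variable {K : Type*} [Field K] {m : ℕ}

/-- coordinates on the supported pieces -/
noncomputable def SpEquiv (s : Set (Fin m → ℤ)) : Sp K s ≃ₗ[K] (s →₀ K) :=
  LinearEquiv.trans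
    { toFun := fun f => (⟨f.1.coeff, by
        rw [Finsupp.mem_supported]
        intro α hα
        exact f.2 α (Finsupp.mem_support_iff.1 hα)⟩ : Finsupp.supported K K s)
      invFun := fun g => ⟨.ofCoeff g.1, by
        intro α hα
        exact (Finsupp.mem_supported _ _).1 g.2 (Finsupp.mem_support_iff.2 hα)⟩
      map_add' := fun _ _ => rfl
      map_smul' := fun _ _ => rfl
      left_inv := fun _ => rfl
      right_inv := fun _ => rfl }
    (Finsupp.supportedEquivFinsupp s)

theorem Ex_univ (N : Fin m → ℤ) :
    Ex Finset.univ Finset.univ N = ((Finset.Icc 0 N : Finset (Fin m → ℤ)) : Set (Fin m → ℤ)) := by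
  ext α
  simp [Ex, Pi.le_def]

theorem finite_Sp (N : Fin m → ℤ) :
    Module.Finite K (Sp K (Ex Finset.univ Finset.univ N)) := by
  rw [Ex_univ]
  exact Module.Finite.equiv (SpEquiv _).symm

theorem finrank_Sp (N : Fin m → ℤ) :
    Module.finrank K (Sp K (Ex Finset.univ Finset.univ N)) = ∏ l, (N l + 1).toNat := by
  rw [Ex_univ, LinearEquiv.finrank_eq (SpEquiv _), Module.finrank_finsupp_self]
  simp [Pi.card_Icc]

/-- product decomposition -/
noncomputable def WWEquiv {B : Type*} (deg : B → ℤ) (e : Fin m → ℤ) (P Q : Finset (Fin m)) :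
    WW K deg e P Q ≃ₗ[K] (∀ b, Sp K (Ex P Q (fun l => e l - 1 - deg b))) where
  toFun := fun v b => ⟨v.1 b, mem_WW.1 v.2 b⟩
  invFun := fun f => ⟨fun b => f b, mem_WW.2 fun b => (f b).2⟩
  map_add' := fun _ _ => rfl
  map_smul' := fun _ _ => rfl
  left_inv := fun _ => rfl
  right_inv := fun _ => rfl

theorem finite_WW {B : Type*} [Fintype B] (deg : B → ℤ) (e : Fin m → ℤ) :
    Module.Finite K (WW K deg e Finset.univ Finset.univ) := by
  have := fun b => finite_Sp (K := K) (fun l => e l - 1 - deg b)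
  exact Module.Finite.equiv (WWEquiv deg e _ _).symm

theorem finrank_WW {B : Type*} [Fintype B] (deg : B → ℤ) (e : Fin m → ℤ) :
    Module.finrank K (WW K deg e Finset.univ Finset.univ) = ∑ b, ∏ l, (e l - deg b).toNat := by
  have := fun b => finite_Sp (K := K) (fun l => e l - 1 - deg b)
  rw [LinearEquiv.finrank_eq (WWEquiv deg e _ _), Module.finrank_pi_fintype]
  apply Finset.sum_congr rfl
  intro b _
  rw [finrank_Sp]
  apply Finset.prod_congr rfl
  intro l _
  congr 1; ring

theorem dim_le {B B' : Type*} [Fintype B] [Fintype B'] (deg : B → ℤ) (deg' : B' → ℤ)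
    (e : Fin m → ℤ) (M : Matrix B' B (LL K m))
    (h : ∀ z ∈ WW K deg' e Finset.univ Finset.univ,
      ∃ a ∈ WW K deg e Finset.univ Finset.univ, M *ᵥ a = z) :
    ∑ b, ∏ l, (e l - deg' b).toNat ≤ ∑ b, ∏ l, (e l - deg b).toNat := by
  rw [← finrank_WW (K := K), ← finrank_WW (K := K)]
  have := finite_WW (K := K) deg e
  let T : (B → LL K m) →ₗ[K] (B' → LL K m) := M.mulVecLin.restrictScalars K
  have hle : WW K deg' e Finset.univ Finset.univ ≤
      (WW K deg e Finset.univ Finset.univ).map T := by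
    intro z hz
    obtain ⟨a, ha, rfl⟩ := h z hz
    exact ⟨a, ha, rfl⟩
  exact (Submodule.finrank_mono hle).trans (Submodule.finrank_map_le T _)

end dim
end MuLB
/-- Let `I ⊂ S = k[x₁,…,xₙ]` be a homogeneous ideal generated in degree
`d`, of height `c ≥ 2`.  Writing `d̄ᵢ = ub i` for the maximal degree at step `i` of the
minimal graded free resolution of `S/I` (characterized by the hypotheses `hub`, `hub'`),
one has the lower bound `μ(I) ≥ (d̄₂ ⋯ d̄_c) / ((d̄₂ − d) ⋯ (d̄_c − d))`. -/
theorem mu_lower_bound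
    (k : Type) [Field k] (n : ℕ) (I : Ideal (MvPolynomial (Fin n) k)) (d : ℕ)
    (hgen : ∃ G : Set (MvPolynomial (Fin n) k),
      (∀ g ∈ G, MvPolynomial.IsHomogeneous g d) ∧ Ideal.span G = I)
    (res : MinGradedFreeRes (MvPolynomial (Fin n) k)
      (fun m => {f | MvPolynomial.IsHomogeneous f m})
      (MvPolynomial (Fin n) k ⧸ I))
    (h0 : ∀ j : ℤ, res.β 0 j = if j = 0 then 1 else 0)
    (h1 : ∀ j : ℤ, res.β 1 j ≠ 0 → j = (d : ℤ))
    (p : ℕ) (hlen : ∀ i, p < i → res.β i = 0) (hp : res.β p ≠ 0)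
    (c : ℕ) (hc : 2 ≤ c) (hht : idealHeight I = (c : ℕ∞))
    (ub : ℕ → ℤ)
    (hub : ∀ (i : ℕ) (j : ℤ), res.β i j ≠ 0 → j ≤ ub i)
    (hub' : ∀ i ≤ p, res.β i (ub i) ≠ 0) :
    (∏ i ∈ Finset.Icc 2 c, (ub i : ℚ) / ((ub i : ℚ) - (d : ℚ))) ≤ (res.tB 1 : ℚ) := by
  classical
  obtain ⟨m, rfl⟩ : ∃ m, c = m + 1 := ⟨c - 1, by omega⟩
  obtain ⟨q, hq⟩ := MuLB.exists_params k n I d hgen (m + 1) hht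
  let φa : MvPolynomial (Fin n) k →ₐ[k] MvPolynomial (Fin (m + 1)) (AlgebraicClosure k) :=
    MvPolynomial.aeval (fun i => MuLB.lf (q i))
  let φ : MvPolynomial (Fin n) k →+* MvPolynomial (Fin (m + 1)) (AlgebraicClosure k) := φa
  have hrad : ∀ l, MvPolynomial.X l ∈ (I.map φ).radical := hq
  have hφ : ∀ f s, MvPolynomial.IsHomogeneous f s → MvPolynomial.IsHomogeneous (φ f) s := by
    intro f s hf
    have := hf.aeval (fun i => MuLB.lf (q i)) (fun i => MuLB.lf_hom (q i))
    rwa [one_mul] at this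
  have hnext := MuLB.exists_next I res φ hφ hrad
  have hBne : ∀ i (b : MuLB.BB res i), res.β i b.1 ≠ 0 := fun i b h =>
    (h ▸ b.2 : Fin 0).elim0
  have hdeg : ∀ i (b : MuLB.BB res i), b.1 ≤ ub i := fun i b => hub i _ (hBne i b)
  let b0 : MuLB.BB res 0 := ⟨0, ⟨0, by rw [h0]; simp⟩⟩
  have hnonempty : ∀ i ≤ m + 1, Nonempty (MuLB.BB res i) := by
    intro i
    induction i with
    | zero => exact fun _ => ⟨b0⟩
    | succ i ih =>
      intro hi
      obtain ⟨b⟩ := ih (by omega)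
      exact ⟨(hnext i (by omega) b).choose⟩
  have hp' : m + 1 ≤ p := by
    by_contra hcon
    obtain ⟨b⟩ := hnonempty (m + 1) le_rfl
    apply hBne _ b
    exact congrFun (hlen (m + 1) (by omega)) b.1
  have hstep : ∀ i < m + 1, ub i < ub (i + 1) := by
    intro i hi
    have h2 := hub' i (by omega)
    obtain ⟨b, hb⟩ := hnext i hi ⟨ub i, ⟨0, Nat.pos_of_ne_zero h2⟩⟩
    exact lt_of_lt_of_le hb (hdeg _ b)
  have hmono : ∀ j ≤ m + 1, ∀ i ≤ j, ub i ≤ ub j := by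
    intro j
    induction j with
    | zero => intro _ i hi; rw [Nat.le_zero.1 hi]
    | succ j ih =>
      intro hj i hi
      rcases Nat.lt_or_ge i (j + 1) with h | h
      · exact (ih (by omega) i (by omega)).trans (hstep j (by omega)).le
      · rw [le_antisymm hi h]
  have hub1 : ub 1 = d := h1 _ (hub' 1 (by omega))
  have hsurj := MuLB.surj (K := AlgebraicClosure k) (B := MuLB.BB res)
    (fun i => (MuLB.DD res i).map φ)
    (fun i => by rw [← Matrix.map_mul, MuLB.DD_mul]; ext; simp)
    (fun i b => b.1) (fun l : Fin m => ub (l.val + 2))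
    (by
      intro i b' b
      rcases res.graded i b.1 b.2 b'.1 b'.2 with h | ⟨s, hs, hh⟩
      · left
        change φ (MuLB.DD res i b' b) = 0
        have : MuLB.DD res i b' b = 0 := h
        rw [this, map_zero]
      · exact Or.inr ⟨s, hs, hφ _ _ hh⟩)
    (by
      intro Q
      have hnull : ∀ f ∈ I, MuLB.NullH (MuLB.DD res) f := fun f hf =>
        MuLB.exists_homotopy res f (by
          intro x
          obtain ⟨g, rfl⟩ := Ideal.Quotient.mk_surjective x
          rw [← Ideal.Quotient.mk_eq_mk, ← Submodule.Quotient.mk_smul, Ideal.Quotient.mk_eq_mk,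
            Ideal.Quotient.eq_zero_iff_mem]
          exact I.mul_mem_right _ hf)
      have htop := MuLB.psi_top I φ hrad Q
      have h2 := MuLB.NullH.of_map
        ((MuLB.psi (AlgebraicClosure k) Q : _ →+* MvPolynomial (Fin m) (AlgebraicClosure k)).comp φ)
        hnull (r := (1 : MvPolynomial (Fin m) (AlgebraicClosure k))) (by rw [htop]; exact Submodule.mem_top)
      have e : (fun i => ((MuLB.DD res i).map φ).map (MuLB.psi (AlgebraicClosure k) Q)) =
          fun i => (MuLB.DD res i).map
            ((MuLB.psi (AlgebraicClosure k) Q : _ →+* MvPolynomial (Fin m) (AlgebraicClosure k)).comp φ) := by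
        funext i
        ext b b'
        simp only [Matrix.map_apply, RingHom.comp_apply, RingHom.coe_coe]
      rw [e]
      exact h2)
    (by
      intro t i hi b
      exact (hdeg i b).trans (hmono _ (by omega) _ hi))
  have hdim := MuLB.dim_le _ _ _ _ hsurj
  have e0 : ∑ b : MuLB.BB res 0, ∏ l : Fin m, (ub (l.val + 2) - b.1).toNat =
      ∏ l : Fin m, (ub (l.val + 2)).toNat := by
    have hz : ∀ b : MuLB.BB res 0, b.1 = 0 := by
      intro b
      by_contra hne
      exact hBne 0 b (by rw [h0, if_neg hne])
    have hc1 : Fintype.card (MuLB.BB res 0) = 1 := by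
      rw [Fintype.card_eq_one_iff]
      refine ⟨b0, ?_⟩
      rintro ⟨j, a⟩
      obtain rfl : j = 0 := hz ⟨j, a⟩
      have : res.β 0 0 = 1 := by rw [h0]; simp
      congr 1
      apply Fin.ext
      have := a.2
      simp only
      omega
    rw [Finset.sum_congr rfl (fun b _ => by rw [hz b])]
    simp [hc1]
  have e1 : ∑ b : MuLB.BB res 1, ∏ l : Fin m, (ub (l.val + 2) - b.1).toNat =
      res.tB 1 * ∏ l : Fin m, (ub (l.val + 2) - d).toNat := by
    rw [Finset.sum_congr rfl (fun b _ => by rw [h1 b.1 (hBne 1 b)])]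
    simp [MuLB.card_BB]
  rw [e0, e1] at hdim
  have hgt : ∀ l : Fin m, (d : ℤ) < ub (l.val + 2) := by
    intro l
    have h2 := hstep 1 (by omega)
    have h3 := hmono (l.val + 2) (by omega) 2 (by omega)
    rw [hub1] at h2
    exact lt_of_lt_of_le h2 h3
  have hdimQ : (∏ l : Fin m, (ub (l.val + 2) : ℚ)) ≤
      res.tB 1 * ∏ l : Fin m, ((ub (l.val + 2) : ℚ) - d) := by
    have h2 : ((∏ l : Fin m, (ub (l.val + 2)).toNat : ℕ) : ℚ) ≤
      ((res.tB 1 * ∏ l : Fin m, (ub (l.val + 2) - d).toNat : ℕ) : ℚ) := by exact_mod_cast hdim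
    push_cast at h2
    have c1 : ∀ x : ℤ, 0 ≤ x → ((x.toNat : ℕ) : ℚ) = x := by
      intro x hx
      have := Int.toNat_of_nonneg hx
      exact_mod_cast congrArg (Int.cast : ℤ → ℚ) this
    have p1 : ∏ l : Fin m, (((ub (l.val + 2)).toNat : ℕ) : ℚ) = ∏ l : Fin m, (ub (l.val + 2) : ℚ) :=
      Finset.prod_congr rfl (fun l _ => c1 (ub (l.val + 2)) (by have := hgt l; omega))
    have p2 : ∏ l : Fin m, (((ub (l.val + 2) - d).toNat : ℕ) : ℚ) =
        ∏ l : Fin m, ((ub (l.val + 2) - d : ℤ) : ℚ) :=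
      Finset.prod_congr rfl (fun l _ => c1 (ub (l.val + 2) - d) (by have := hgt l; omega))
    rw [p1, p2] at h2
    push_cast at h2
    exact h2
  have hre : (∏ i ∈ Finset.Icc 2 (m + 1), (ub i : ℚ) / ((ub i : ℚ) - (d : ℚ))) =
      ∏ l : Fin m, ((ub (l.val + 2) : ℚ) / ((ub (l.val + 2) : ℚ) - d)) := by
    rw [Fin.prod_univ_eq_prod_range (fun l => (ub (l + 2) : ℚ) / ((ub (l + 2) : ℚ) - d)) m]
    rw [Finset.range_eq_Ico, Finset.prod_Ico_add' (fun i => (ub i : ℚ) / ((ub i : ℚ) - d)) 0 m 2]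
    apply Finset.prod_congr _ (fun _ _ => rfl)
    ext i; simp; omega
  rw [hre, Finset.prod_div_distrib, div_le_iff₀]
  · exact hdimQ
  · apply Finset.prod_pos
    intro l _
    have := hgt l
    rw [sub_pos]
    exact_mod_cast this
end

section
/- Let I ⊂ S = k[x_1,…,x_n] be a homogeneous ideal generated in degree d, of height c ≥ 2, with upper degree sequence d̄ and lower degree sequence d̲. Then β_c(S/I) ≥ (d · d̲_2 ⋯ d̲_{c−1}) / ((d̄_c − d)(d̄_c − d̲_2) ⋯ (d̄_c − d̲_{c−1})). -/
namespace BCLB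
open Function

abbrev Cht (m : ℕ) := Fin m → Option Bool

def eps (t : Bool) : ℤ := if t then 1 else -1

theorem eps_mul (t : Bool) : eps t * eps t = 1 := by cases t <;> simp [eps]

def sgn {m : ℕ} (σ : Cht m) (l : Fin m) : ℤ :=
  ∏ l' ∈ Finset.univ.filter (· < l), (if σ l' = none then -1 else 1)

theorem sgn_mul {m : ℕ} (σ : Cht m) (l : Fin m) : sgn σ l * sgn σ l = 1 := by
  unfold sgn
  rw [← Finset.prod_mul_distrib]
  apply Finset.prod_eq_one
  intro i _
  split_ifs <;> simp

theorem sgn_update_ge {m : ℕ} (σ : Cht m) (l l' : Fin m) (h : l ≤ l') (t : Option Bool) :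
    sgn (update σ l' t) l = sgn σ l := by
  unfold sgn
  apply Finset.prod_congr rfl
  intro i hi
  simp at hi
  rw [update_of_ne (by omega)]

theorem sgn_update_lt {m : ℕ} (σ : Cht m) (l l' : Fin m) (h : l' < l) (hl' : σ l' = none) (t : Bool) :
    sgn (update σ l' (some t)) l = - sgn σ l := by
  unfold sgn
  have hm : l' ∈ Finset.univ.filter (· < l) := by simpa using h
  rw [← Finset.mul_prod_erase _ _ hm, ← Finset.mul_prod_erase _ _ hm]
  simp only [update_self, hl', if_true]
  simp
  apply Finset.prod_congr rfl
  intro i hi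
  simp at hi
  rw [update_of_ne hi.1]

theorem sgn_anti {m : ℕ} (σ : Cht m) (l l' : Fin m) (h : l ≠ l') (hl : σ l = none) (hl' : σ l' = none)
    (t t' : Bool) : sgn σ l * sgn (update σ l (some t)) l' =
      - (sgn σ l' * sgn (update σ l' (some t')) l) := by
  rcases lt_or_gt_of_ne h with h | h
  · rw [sgn_update_lt σ l' l h hl, sgn_update_ge σ l l' h.le]; ring
  · rw [sgn_update_lt σ l l' h hl', sgn_update_ge σ l' l h.le]; ring

variable {W : Type*} [AddCommGroup W] {m : ℕ}

def dlt (x : Cht m → W) (σ : Cht m) : W :=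
  ∑ l, if σ l = none then sgn σ l • ∑ t : Bool, eps t • x (update σ l (some t)) else 0

theorem dlt_add (x y : Cht m → W) : dlt (x + y) = dlt x + dlt y := by
  funext σ
  simp only [dlt, Pi.add_apply, ← Finset.sum_add_distrib]
  refine Finset.sum_congr rfl fun l _ => ?_
  split_ifs
  · simp only [smul_add, Finset.sum_add_distrib]
  · simp

theorem dlt_map {W' : Type*} [AddCommGroup W'] {F : Type*} [FunLike F W W'] [AddMonoidHomClass F W W']
    (f : F) (x : Cht m → W) (σ : Cht m) :
    dlt (fun τ => f (x τ)) σ = f (dlt x σ) := by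
  simp only [dlt, map_sum]
  refine Finset.sum_congr rfl fun l _ => ?_
  split_ifs
  · rw [map_zsmul, map_sum]
    simp only [map_zsmul]
  · simp

theorem dlt_dlt (x : Cht m → W) : dlt (dlt x) = 0 := by
  funext σ
  have h1 : ∀ l l' : Fin m, ∀ t : Bool, σ l = none →
      ((if (update σ l (some t)) l' = none then sgn (update σ l (some t)) l' •
        ∑ t' : Bool, eps t' • x (update (update σ l (some t)) l' (some t')) else 0) =
      if (σ l' = none ∧ l ≠ l') then sgn (update σ l (some t)) l' •
        ∑ t' : Bool, eps t' • x (update (update σ l (some t)) l' (some t')) else 0) := by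
    intro l l' t hl
    by_cases h : l = l'
    · subst h; simp
    · rw [update_of_ne (Ne.symm h)]; simp [h]
  let T : Fin m × Fin m → W := fun p => if σ p.1 = none ∧ σ p.2 = none ∧ p.1 ≠ p.2 then
    ∑ t : Bool, ∑ t' : Bool, (sgn σ p.1 * sgn (update σ p.1 (some t)) p.2 * (eps t * eps t')) •
      x (update (update σ p.1 (some t)) p.2 (some t')) else 0
  have h2 : dlt (dlt x) σ = ∑ p : Fin m × Fin m, T p := by
    rw [Fintype.sum_prod_type]
    refine Finset.sum_congr rfl fun l _ => ?_
    by_cases hl : σ l = none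
    · simp only [hl, if_true, dlt]
      simp only [h1 l _ _ hl]
      simp only [Finset.smul_sum]
      rw [Finset.sum_comm]
      refine Finset.sum_congr rfl fun l' _ => ?_
      simp only [T, hl, true_and]
      by_cases hl' : σ l' = none ∧ l ≠ l'
      · simp only [if_pos hl']
        refine Finset.sum_congr rfl fun t _ => ?_
        simp only [Finset.smul_sum]
        refine Finset.sum_congr rfl fun t' _ => ?_
        simp only [smul_smul]
        congr 1; ring
      · simp [if_neg hl']
    · simp [T, hl]
  rw [h2, Pi.zero_apply]
  refine Finset.sum_involution (fun p _ => p.swap) ?_ ?_ (fun _ _ => Finset.mem_univ _) ?_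
  · rintro ⟨l, l'⟩ _
    simp only [T, Prod.swap]
    by_cases h : σ l = none ∧ σ l' = none ∧ l ≠ l'
    · rw [if_pos h, if_pos ⟨h.2.1, h.1, h.2.2.symm⟩]
      rw [Finset.sum_comm (s := Finset.univ (α := Bool)), ← Finset.sum_add_distrib]
      refine Finset.sum_eq_zero fun t' _ => ?_
      rw [← Finset.sum_add_distrib]
      refine Finset.sum_eq_zero fun t _ => ?_
      rw [update_comm h.2.2, sgn_anti σ l l' h.2.2 h.1 h.2.1 t t', ← add_smul]
      convert zero_smul ℤ _ using 2
      ring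
    · rw [if_neg h, if_neg (fun h' => h ⟨h'.2.1, h'.1, h'.2.2.symm⟩), add_zero]
  · rintro ⟨l, l'⟩ _ hne heq
    apply hne
    simp only [Prod.swap, Prod.mk.injEq] at heq
    simp [T, heq.1]
  · rintro ⟨l, l'⟩ _; rfl

/-- contracting homotopy in direction `l` -/
def hot (l : Fin m) (t : Bool) (x : Cht m → W) (σ : Cht m) : W :=
  if σ l = some t then (eps t * sgn σ l) • x (update σ l none) else 0

theorem dlt_hot (l : Fin m) (t : Bool) (x : Cht m → W)
    (hx : ∀ σ, σ l = some (!t) → x σ = 0) (hd : dlt x = 0) : dlt (hot l t x) = x := by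
  funext σ
  rcases hσ : σ l with _ | b
  · unfold dlt
    rw [Finset.sum_eq_single l]
    · rw [if_pos hσ, Finset.sum_eq_single t]
      · simp only [hot, update_self, if_true, update_idem]
        rw [sgn_update_ge σ l l le_rfl, smul_smul, smul_smul, ← hσ, update_eq_self]
        rw [show sgn σ l * eps t * (eps t * sgn σ l) = (sgn σ l * sgn σ l) * (eps t * eps t) by ring,
          sgn_mul, eps_mul, one_mul, one_smul]
      · intro b _ hb
        simp [hot, hb]
      · simp
    · intro l' _ hl'
      split_ifs
      · simp [hot, update_of_ne hl'.symm, hσ]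
      · rfl
    · simp
  · by_cases hb : b = t
    · subst hb
      have h0 : dlt x (update σ l none) = 0 := by rw [hd]; rfl
      unfold dlt at h0
      rw [← Finset.add_sum_erase _ _ (Finset.mem_univ l)] at h0
      rw [if_pos (by simp), Finset.sum_eq_single b, update_idem, sgn_update_ge σ l l le_rfl,
        ← hσ, update_eq_self, smul_smul] at h0
      · unfold dlt
        rw [← Finset.add_sum_erase _ _ (Finset.mem_univ l), if_neg (by simp [hσ]), zero_add]
        have h3 : x σ = - ((sgn σ l * eps b) • ∑ l' ∈ Finset.univ.erase l,
            if update σ l none l' = none then sgn (update σ l none) l' •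
              ∑ t : Bool, eps t • x (update (update σ l none) l' (some t)) else 0) := by
          rw [add_comm, add_eq_zero_iff_eq_neg] at h0
          rw [h0, smul_neg, neg_neg, smul_smul,
            show sgn σ l * eps b * (sgn σ l * eps b) = (sgn σ l * sgn σ l) * (eps b * eps b) by ring,
            sgn_mul, eps_mul, one_mul, one_smul]
        rw [h3, Finset.smul_sum, ← Finset.sum_neg_distrib]
        refine Finset.sum_congr rfl fun l' hl' => ?_
        have hne : l' ≠ l := (Finset.mem_erase.1 hl').1
        rw [update_of_ne hne]
        by_cases hn : σ l' = none
        · rw [if_pos hn, if_pos hn, Finset.smul_sum, Finset.smul_sum, Finset.smul_sum,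
            ← Finset.sum_neg_distrib]
          refine Finset.sum_congr rfl fun t _ => ?_
          simp only [hot, update_of_ne hne.symm, hσ, if_true, smul_smul]
          rw [update_comm hne, ← neg_smul]
          congr 1
          have hs : sgn σ l' * sgn (update σ l' (some t)) l = - (sgn σ l * sgn (update σ l none) l') := by
            rcases lt_or_gt_of_ne hne with h | h
            · rw [sgn_update_lt _ _ _ h hn, sgn_update_ge _ _ _ h.le]; ring
            · have h5 := sgn_update_lt (update σ l none) l' l h (by simp) b
              rw [update_idem, ← hσ, update_eq_self] at h5
              rw [sgn_update_ge σ l l' h.le, h5]; ring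
          linear_combination (eps t * eps b) * hs
        · rw [if_neg hn, if_neg hn, smul_zero, neg_zero]
      · intro b' _ hb'
        rw [hx, smul_zero]
        rw [update_self]
        cases b <;> cases b' <;> simp_all
      · simp
    · have hb' : b = !t := by cases b <;> cases t <;> simp_all
      rw [hx σ (by rw [hσ, hb'])]
      unfold dlt
      refine Finset.sum_eq_zero fun l' _ => ?_
      split_ifs with hn
      · have hne : l' ≠ l := by rintro rfl; simp [hσ] at hn
        simp [hot, update_of_ne hne.symm, hσ, hb]
      · rfl
end BCLB
namespace BCLB
open Function

abbrev Lr (K : Type) [Field K] (m : ℕ) := AddMonoidAlgebra K (Fin m → ℤ)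

def Ok : Option Bool → ℤ → ℤ → Prop
  | none, _, _ => True
  | some false, _, e => 0 ≤ e
  | some true, N, e => e ≤ N

theorem Ok.add {s : Option Bool} {N N' e e' : ℤ} (h : Ok s N e) (h' : Ok s N' e') :
    Ok s (N + N') (e + e') := by
  rcases s with _ | _ | _
  · trivial
  · exact add_nonneg h h'
  · exact add_le_add h h'

section
variable {K : Type} [Field K] {m : ℕ}

def box (σ : Cht m) (N : Fin m → ℤ) : Submodule K (Lr K m) where
  carrier := {f | ∀ e, f.coeff e ≠ 0 → ∀ l, Ok (σ l) (N l) (e l)}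
  zero_mem' := by intro e he; simp at he
  add_mem' := by
    intro f g hf hg e he
    by_cases h : f.coeff e = 0
    · apply hg e
      intro h'
      apply he
      simp [h, h']
    · exact hf e h
  smul_mem' := by
    intro a f hf e he
    apply hf e
    intro h
    apply he
    simp [h]

theorem mem_box {σ : Cht m} {N : Fin m → ℤ} {f : Lr K m} :
    f ∈ box σ N ↔ ∀ e, f.coeff e ≠ 0 → ∀ l, Ok (σ l) (N l) (e l) := Iff.rfl

theorem mul_mem_box {σ : Cht m} {N N' : Fin m → ℤ} {f g : Lr K m} (hf : f ∈ box σ N)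
    (hg : g ∈ box σ N') : f * g ∈ box σ (N + N') := by
  classical
  intro e he
  have h1 : e ∈ (f * g).coeff.support := Finsupp.mem_support_iff.2 he
  have h2 := AddMonoidAlgebra.support_coeff_mul_subset f g h1
  obtain ⟨a, ha, b, hb, rfl⟩ := Finset.mem_add.1 h2
  intro l
  exact (hf a (Finsupp.mem_support_iff.1 ha) l).add (hg b (Finsupp.mem_support_iff.1 hb) l)

theorem single_mem_box {σ : Cht m} {N : Fin m → ℤ} {e : Fin m → ℤ} {a : K}
    (h : ∀ l, Ok (σ l) (N l) (e l)) : (AddMonoidAlgebra.single e a : Lr K m) ∈ box σ N := by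
  classical
  intro e' he'
  have : e = e' := by
    by_contra hne
    apply he'
    simp [AddMonoidAlgebra.coeff_single, Finsupp.single_apply, hne]
  subst this
  exact h

def cf (e : Fin m → ℤ) : Lr K m →ₗ[K] K where
  toFun f := f.coeff e
  map_add' f g := by simp
  map_smul' a f := by simp

theorem cf_apply (e : Fin m → ℤ) (f : Lr K m) : cf e f = f.coeff e := rfl

theorem lr_ext {f g : Lr K m} (h : ∀ e, cf e f = cf e g) : f = g := by
  apply AddMonoidAlgebra.ext
  ext e
  exact h e

def nAB (σ : Cht m) : ℕ := (Finset.univ.filter (fun l => σ l = none)).card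

theorem nAB_update_none (σ : Cht m) (l : Fin m) (t : Bool) (h : σ l = some t) :
    nAB (update σ l none) = nAB σ + 1 := by
  unfold nAB
  rw [show Finset.univ.filter (fun l' => update σ l none l' = none) =
    insert l (Finset.univ.filter (fun l => σ l = none)) from ?_, Finset.card_insert_of_notMem]
  · simp [h]
  · ext l'
    by_cases hl : l' = l
    · subst hl; simp
    · simp [update_of_ne hl, hl]

theorem nAB_update_some (σ : Cht m) (l : Fin m) (t : Bool) (h : σ l = none) :
    nAB (update σ l (some t)) + 1 = nAB σ := by
  rw [← nAB_update_none (update σ l (some t)) l t (by simp), update_idem, ← h, update_eq_self]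

theorem vanish (b : Fin m → ℤ) (q : ℕ) (y : Cht m → Lr K m) (hy : ∀ σ, y σ ∈ box σ b)
    (hq : ∀ σ, y σ ≠ 0 → nAB σ + 1 = q) (hd : dlt y = 0)
    (hE : ∀ e σ, cf e (y σ) ≠ 0 → ∃ l t, Ok (some t) (b l) (e l) ∧ ¬ Ok (some !t) (b l) (e l)) :
    ∃ u : Cht m → Lr K m, (∀ σ, u σ ∈ box σ b) ∧ (∀ σ, u σ ≠ 0 → nAB σ + 1 + 1 = q) ∧ dlt u = y := by
  classical
  let E : Finset (Fin m → ℤ) := Finset.univ.biUnion fun σ => (y σ).coeff.support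
  have hmem : ∀ e, e ∈ E ↔ ∃ σ, cf e (y σ) ≠ 0 := by
    intro e; simp [E, cf_apply]
  have hE' : ∀ e, e ∈ E → ∃ l t, Ok (some t) (b l) (e l) ∧ ¬ Ok (some !t) (b l) (e l) := by
    intro e he
    obtain ⟨σ, hσ⟩ := (hmem e).1 he
    exact hE e σ hσ
  choose lf tf hlt using hE'
  let w : (e : Fin m → ℤ) → Cht m → K := fun e σ =>
    if he : e ∈ E then hot (lf e he) (tf e he) (fun τ => cf e (y τ)) σ else 0
  let u : Cht m → Lr K m := fun σ => ∑ e ∈ E, AddMonoidAlgebra.single e (w e σ)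
  have hu : ∀ e σ, cf e (u σ) = w e σ := by
    intro e σ
    simp only [u, map_sum]
    have h1 : ∀ e', cf e (AddMonoidAlgebra.single e' (w e' σ) : Lr K m) = if e' = e then w e σ else 0 := by
      intro e'
      rw [cf_apply, AddMonoidAlgebra.coeff_single, Finsupp.single_apply]
      split_ifs with h
      · rw [h]
      · rfl
    simp only [h1]
    rw [Finset.sum_ite_eq']
    split_ifs with he
    · rfl
    · simp [w, he]
  have hw : ∀ e σ, w e σ ≠ 0 → ∃ he : e ∈ E, σ (lf e he) = some (tf e he) ∧
      cf e (y (update σ (lf e he) none)) ≠ 0 := by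
    intro e σ h
    by_cases he : e ∈ E
    · refine ⟨he, ?_⟩
      simp only [w, dif_pos he, hot] at h
      split_ifs at h with h1
      · refine ⟨h1, fun h2 => h ?_⟩
        rw [h2, smul_zero]
      · exact absurd rfl h
    · simp [w, he] at h
  refine ⟨u, ?_, ?_, ?_⟩
  · intro σ e he l
    rw [← cf_apply, hu] at he
    obtain ⟨heE, h1, h2⟩ := hw e σ he
    by_cases hl : l = lf e heE
    · subst hl; rw [h1]; exact (hlt e heE).1
    · have := hy _ e h2 l
      rwa [update_of_ne hl] at this
  · intro σ hσ
    have : ∃ e, cf e (u σ) ≠ 0 := by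
      by_contra hcon
      push Not at hcon
      exact hσ (lr_ext fun e => by rw [hcon e, map_zero])
    obtain ⟨e, he⟩ := this
    rw [hu] at he
    obtain ⟨heE, h1, h2⟩ := hw e σ he
    have h3 := hq (update σ (lf e heE) none) (fun h => h2 (by rw [h, map_zero]))
    rw [nAB_update_none _ _ _ h1] at h3
    exact h3
  · funext σ
    apply lr_ext
    intro e
    rw [← dlt_map (cf e) u σ]
    simp only [hu]
    by_cases he : e ∈ E
    · have h1 := dlt_hot (lf e he) (tf e he) (fun τ => cf e (y τ)) (by
        intro τ hτ
        by_contra hne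
        have := hy τ e hne (lf e he)
        rw [hτ] at this
        exact (hlt e he).2 this) (by
        funext τ
        rw [dlt_map, hd]; simp)
      have h2 : (fun τ => w e τ) = hot (lf e he) (tf e he) (fun τ => cf e (y τ)) := by
        funext τ; simp [w, he]
      rw [h2, h1]
    · have h3 : cf e (y σ) = 0 := by
        by_contra hne
        exact he ((hmem e).2 ⟨σ, hne⟩)
      have h2 : (fun τ => w e τ) = fun _ => 0 := by
        funext τ; simp [w, he]
      rw [h2, h3]
      simp [dlt]
end
end BCLB
namespace BCLB
open Function

section
variable {K : Type} [Field K] {m : ℕ}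

theorem box_congr {σ : Cht m} {N N' : Fin m → ℤ} (h : ∀ l, σ l = some true → N l = N' l) :
    (box σ N : Submodule K (Lr K m)) ≤ box σ N' := by
  intro f hf e he l
  have h1 := hf e he l
  rcases hσ : σ l with _ | _ | _
  · trivial
  · rw [hσ] at h1; exact h1
  · rw [hσ, h l hσ] at h1; exact h1

theorem one_mem_box (σ : Cht m) : (1 : Lr K m) ∈ box σ 0 := by
  rw [AddMonoidAlgebra.one_def]
  apply single_mem_box
  intro l
  rcases σ l with _ | _ | _
  · trivial
  · exact le_rfl
  · exact le_rfl

theorem prod_mem_box {ι : Type*} (s : Finset ι) {σ : Cht m} {N : ι → Fin m → ℤ} {f : ι → Lr K m}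
    (h : ∀ i ∈ s, f i ∈ box σ (N i)) : ∏ i ∈ s, f i ∈ box σ (∑ i ∈ s, N i) := by
  classical
  induction s using Finset.induction_on with
  | empty => simpa using one_mem_box σ
  | insert i s hi ih =>
    rw [Finset.prod_insert hi, Finset.sum_insert hi]
    exact mul_mem_box (h i (Finset.mem_insert_self _ _)) (ih fun j hj => h j (Finset.mem_insert_of_mem hj))

theorem pow_mem_box {σ : Cht m} {a : ℤ} {f : Lr K m} (h : f ∈ box σ (fun _ => a)) (D : ℕ) :
    f ^ D ∈ box σ (fun _ => a * D) := by
  induction D with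
  | zero => rw [pow_zero]; exact box_congr (N := 0) (by intro l _; simp) (one_mem_box σ)
  | succ D ih =>
    rw [pow_succ]
    have := mul_mem_box ih h
    refine box_congr ?_ this
    intro l _
    simp only [Pi.add_apply]
    push_cast; ring

noncomputable def zz (l : Fin m) (a : ℤ) : Lr K m := AddMonoidAlgebra.single (Pi.single l a) 1

theorem zz_mul (l : Fin m) : (zz l 1 : Lr K m) * zz l (-1) = 1 := by
  simp [zz, AddMonoidAlgebra.single_mul_single, ← Pi.single_add, AddMonoidAlgebra.one_def]

noncomputable def yL (K : Type) [Field K] (m : ℕ) : Polynomial (Lr K m) :=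
  ∏ l : Fin m, (1 + Polynomial.C (zz l 1) * Polynomial.X)

noncomputable def zT (K : Type) [Field K] (σ : Cht m) (a : ℤ) : Lr K m :=
  ∏ l, if σ l = some true then zz l a else 1

theorem zT_mul (σ : Cht m) : zT K σ 1 * zT K σ (-1) = 1 := by
  unfold zT
  rw [← Finset.prod_mul_distrib]
  apply Finset.prod_eq_one
  intro l _
  split_ifs
  · exact zz_mul l
  · simp

theorem zT_mem (σ : Cht m) (a : ℤ) : zT K σ a ∈ box σ (fun _ => a) := by
  classical
  have h := prod_mem_box (K := K) Finset.univ (σ := σ)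
    (N := fun l => if σ l = some true then Pi.single l a else 0)
    (f := fun l => if σ l = some true then zz l a else 1) (by
      intro l _
      by_cases h : σ l = some true
      · simp only [if_pos h]
        apply single_mem_box
        intro l'
        rcases hl : σ l' with _ | _ | _
        · trivial
        · have : l' ≠ l := by rintro rfl; rw [h] at hl; cases hl
          simp [Ok, this]
        · exact le_rfl
      · simp only [if_neg h]
        exact one_mem_box σ)
  refine box_congr ?_ h
  intro l hl
  rw [Finset.sum_apply, Finset.sum_eq_single l]
  · simp [hl]
  · intro l' _ hne
    split_ifs
    · simp [hne.symm]
    · rfl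
  · simp

noncomputable def yT (K : Type) [Field K] (σ : Cht m) : Polynomial (MvPolynomial (Fin m) K) :=
  ∏ l, if σ l = some true then Polynomial.C (MvPolynomial.X l) + Polynomial.X
    else 1 + Polynomial.C (MvPolynomial.X l) * Polynomial.X

noncomputable def psi (K : Type) [Field K] (σ : Cht m) : MvPolynomial (Fin m) K →ₐ[K] Lr K m :=
  MvPolynomial.aeval fun l => if σ l = some true then zz l (-1) else zz l 1

theorem psi_yT (σ : Cht m) : (yT K σ).map (psi K σ : MvPolynomial (Fin m) K →+* Lr K m) =
    Polynomial.C (zT K σ (-1)) * yL K m := by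
  unfold yT yL zT
  rw [Polynomial.map_prod, map_prod, ← Finset.prod_mul_distrib]
  refine Finset.prod_congr rfl fun l _ => ?_
  by_cases h : σ l = some true
  · simp only [if_pos h, Polynomial.map_add, Polynomial.map_C, Polynomial.map_X, RingHom.coe_coe]
    rw [psi, MvPolynomial.aeval_X, if_pos h, mul_add, mul_one, ← mul_assoc, ← Polynomial.C_mul,
      mul_comm (zz l (-1)), zz_mul, Polynomial.C_1, one_mul]
  · simp only [if_neg h, Polynomial.map_add, Polynomial.map_mul, Polynomial.map_one, Polynomial.map_C,
      Polynomial.map_X, RingHom.coe_coe, Polynomial.C_1, one_mul]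
    rw [psi, MvPolynomial.aeval_X, if_neg h]

theorem psi_mem (σ : Cht m) (f : MvPolynomial (Fin m) K) : psi K σ f ∈ box σ 0 := by
  induction f using MvPolynomial.induction_on with
  | C a =>
    have : psi K σ (MvPolynomial.C a) = a • (1 : Lr K m) := by
      rw [psi, MvPolynomial.aeval_C, Algebra.algebraMap_eq_smul_one]
    rw [this]
    exact Submodule.smul_mem _ _ (one_mem_box σ)
  | add p q hp hq => rw [map_add]; exact add_mem hp hq
  | mul_X p l hp =>
    rw [map_mul]
    have h : psi K σ (MvPolynomial.X l) ∈ box σ (0 : Fin m → ℤ) := by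
      rw [psi, MvPolynomial.aeval_X]
      by_cases h : σ l = some true
      · rw [if_pos h]
        apply single_mem_box
        intro l'
        by_cases hl : l' = l
        · subst hl; rw [h]; simp [Ok]
        · rw [Pi.single_eq_of_ne hl]
          rcases σ l' with _ | _ | _ <;> simp [Ok]
      · rw [if_neg h]
        apply single_mem_box
        intro l'
        by_cases hl : l' = l
        · subst hl
          rcases hs : σ l' with _ | _ | _
          · trivial
          · simp [Ok]
          · exact absurd hs h
        · rw [Pi.single_eq_of_ne hl]
          rcases σ l' with _ | _ | _ <;> simp [Ok]
    have := mul_mem_box hp h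
    simpa using this

variable {k : Type} [Field k] [Algebra k K] {n : ℕ}

noncomputable def phi (A : Fin n → Fin (m+1) → K) : MvPolynomial (Fin n) k →+* Lr K m :=
  MvPolynomial.eval₂Hom ((algebraMap K (Lr K m)).comp (algebraMap k K))
    (fun i => ∑ a, algebraMap K _ (A i a) * (yL K m).coeff a)

noncomputable def phiT (σ : Cht m) (A : Fin n → Fin (m+1) → K) :
    MvPolynomial (Fin n) k →+* MvPolynomial (Fin m) K :=
  MvPolynomial.eval₂Hom ((algebraMap K _).comp (algebraMap k K))
    (fun i => ∑ a, algebraMap K _ (A i a) * (yT K σ).coeff a)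

theorem eval₂_scale {R S' : Type*} [CommRing R] [CommRing S'] (g : R →+* S') (v : Fin n → S') (a : S')
    (f : MvPolynomial (Fin n) R) (D : ℕ) (hf : f.IsHomogeneous D) :
    MvPolynomial.eval₂ g (fun i => a * v i) f = a ^ D * MvPolynomial.eval₂ g v f := by
  rw [MvPolynomial.eval₂_eq', MvPolynomial.eval₂_eq', Finset.mul_sum]
  refine Finset.sum_congr rfl fun e he => ?_
  simp only [mul_pow, Finset.prod_mul_distrib, Finset.prod_pow_eq_pow_sum]
  have : ∑ i, e i = D := by
    have := hf.degree_eq_sum_deg_support he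
    rw [this]
    exact (Finset.sum_subset (Finset.subset_univ _) (by intro i _ h; simpa using h)).symm
  rw [this]; ring

theorem psi_phiT (σ : Cht m) (A : Fin n → Fin (m+1) → K) (f : MvPolynomial (Fin n) k) (D : ℕ)
    (hf : f.IsHomogeneous D) : psi K σ (phiT σ A f) = zT K σ (-1) ^ D * phi A f := by
  have h1 : ∀ a : ℕ, psi K σ ((yT K σ).coeff a) = zT K σ (-1) * (yL K m).coeff a := by
    intro a
    have := congrArg (fun p => Polynomial.coeff p a) (psi_yT (K := K) σ)
    simpa [Polynomial.coeff_map] using this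
  unfold phi
  rw [MvPolynomial.coe_eval₂Hom, ← eval₂_scale _ _ _ _ _ hf]
  unfold phiT
  rw [MvPolynomial.coe_eval₂Hom]
  have h2 := MvPolynomial.eval₂_comp_left (psi K σ : MvPolynomial (Fin m) K →+* Lr K m)
    ((algebraMap K (MvPolynomial (Fin m) K)).comp (algebraMap k K))
    (fun i => ∑ a : Fin (m+1), algebraMap K _ (A i a) * (yT K σ).coeff a) f
  rw [RingHom.coe_coe] at h2
  rw [h2]
  congr 1
  · ext x; simp
  · funext i
    simp only [comp_apply, map_sum, map_mul, AlgHom.commutes, h1, Finset.mul_sum]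
    refine Finset.sum_congr rfl fun a _ => ?_
    ring

theorem phi_mem (σ : Cht m) (A : Fin n → Fin (m+1) → K) (f : MvPolynomial (Fin n) k) (D : ℕ)
    (hf : f.IsHomogeneous D) : phi A f ∈ box σ (fun _ => (D : ℤ)) := by
  have h := psi_phiT σ A f D hf
  have h2 : phi A f = zT K σ 1 ^ D * psi K σ (phiT σ A f) := by
    rw [h, ← mul_assoc, ← mul_pow, zT_mul, one_pow, one_mul]
  rw [h2]
  have := mul_mem_box (pow_mem_box (zT_mem (K := K) σ 1) D) (psi_mem σ (phiT σ A f))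
  refine box_congr ?_ this
  intro l _; simp

theorem exists_unit (σ : Cht m) (A : Fin n → Fin (m+1) → K) (d : ℕ)
    (G : Set (MvPolynomial (Fin n) k)) (hG : ∀ g ∈ G, g.IsHomogeneous d)
    (hA : ∀ (κ : Type) [Field κ] [Algebra K κ] (y : Fin (m+1) → κ),
      (∀ f ∈ G, MvPolynomial.eval₂ ((algebraMap K κ).comp (algebraMap k K))
        (fun i => ∑ l, algebraMap K κ (A i l) * y l) f = 0) → y = 0) :
    ∃ (N : ℕ) (a : Fin N → MvPolynomial (Fin n) k) (r : Fin N → Lr K m), (∀ i, a i ∈ G) ∧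
      (∀ i, r i ∈ box σ (fun _ => -(d : ℤ))) ∧ ∑ i, r i * phi A (a i) = 1 := by
  have htop : Ideal.span (phiT σ A '' G) = ⊤ := by
    by_contra hne
    obtain ⟨M, hM, hle⟩ := Ideal.exists_le_maximal _ hne
    let κ := MvPolynomial (Fin m) K ⧸ M
    letI : Field κ := Ideal.Quotient.field M
    have hy := hA κ (fun a => Ideal.Quotient.mk M ((yT K σ).coeff a)) (by
      intro f hf
      have h1 : Ideal.Quotient.mk M (phiT σ A f) = 0 :=
        Ideal.Quotient.eq_zero_iff_mem.2 (hle (Ideal.subset_span ⟨f, hf, rfl⟩))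
      unfold phiT at h1
      rw [MvPolynomial.coe_eval₂Hom, MvPolynomial.eval₂_comp_left] at h1
      rw [← h1]
      congr 1
      funext i
      simp only [comp_apply, map_sum, map_mul]
      rfl)
    have hdeg : (yT K σ).natDegree ≤ m := by
      unfold yT
      refine (Polynomial.natDegree_prod_le _ _).trans ?_
      refine (Finset.sum_le_card_nsmul _ _ 1 ?_).trans (by simp)
      intro l _
      split_ifs <;> compute_degree
    have hz : (yT K σ).map (Ideal.Quotient.mk M) = 0 := by
      ext a
      rw [Polynomial.coeff_map, Polynomial.coeff_zero]
      by_cases ha : a < m + 1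
      · exact congrFun hy ⟨a, ha⟩
      · rw [Polynomial.coeff_eq_zero_of_natDegree_lt (by omega), map_zero]
    unfold yT at hz
    rw [Polynomial.map_prod, Finset.prod_eq_zero_iff] at hz
    obtain ⟨l, -, hl⟩ := hz
    split_ifs at hl with h
    · have := congrArg (fun p => Polynomial.coeff p 1) hl
      simp [Polynomial.coeff_C] at this
    · have := congrArg (fun p => Polynomial.coeff p 0) hl
      simp at this
  have h1 : (1 : MvPolynomial (Fin m) K) ∈ Ideal.span (phiT σ A '' G) := by rw [htop]; trivial
  obtain ⟨N, f, g, hfg⟩ := Submodule.mem_span_set'.1 h1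
  choose a ha hga using fun i => (g i).2
  refine ⟨N, a, fun i => psi K σ (f i) * zT K σ (-1) ^ d, ha, ?_, ?_⟩
  · intro i
    have := mul_mem_box (psi_mem σ (f i)) (pow_mem_box (zT_mem (K := K) σ (-1)) d)
    refine box_congr ?_ this
    intro l _; simp
  · have := congrArg (psi K σ) hfg
    rw [map_sum, map_one] at this
    rw [← this]
    refine Finset.sum_congr rfl fun i _ => ?_
    rw [smul_eq_mul, map_mul, ← hga i, psi_phiT σ A (a i) d (hG _ (ha i)), mul_assoc]
end
end BCLB

namespace BCLB
open MvPolynomial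

noncomputable def lin {K : Type} [Field K] {n : ℕ} : (Fin n → K) →ₗ[K] MvPolynomial (Fin n) K where
  toFun v := ∑ i, C (v i) * X i
  map_add' v w := by simp [add_mul, Finset.sum_add_distrib]
  map_smul' a v := by simp [Finset.smul_sum, smul_eq_C_mul, mul_assoc]

theorem lin_single {K : Type} [Field K] {n : ℕ} (i : Fin n) :
    lin (Pi.single i (1:K)) = X i := by
  classical
  simp only [lin, LinearMap.coe_mk, AddHom.coe_mk]
  rw [Finset.sum_eq_single i]
  · simp
  · intro b _ hb; simp [Pi.single_eq_of_ne hb]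
  · simp

theorem lin_homog {K : Type} [Field K] {n : ℕ} (v : Fin n → K) : (lin v).IsHomogeneous 1 := by
  apply IsHomogeneous.sum
  intro i _
  exact isHomogeneous_C_mul_X _ _

theorem exists_lin {K : Type} [Field K] [Infinite K] {n : ℕ} (G : Set (MvPolynomial (Fin n) K))
    (c : ℕ) (hG : ∀ P : Ideal (MvPolynomial (Fin n) K), P.IsPrime → G ⊆ P → (c : ℕ∞) ≤ P.height)
    (r : ℕ) : ∃ l : Fin r → (Fin n → K), ∀ P : Ideal (MvPolynomial (Fin n) K), P.IsPrime → G ⊆ P →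
      (∀ i, lin (l i) ∈ P) → (∀ i, X i ∈ P) ∨ ((c + r : ℕ) : ℕ∞) ≤ P.height := by
  induction r with
  | zero => exact ⟨Fin.elim0, fun P hP hGP _ => Or.inr (by simpa using hG P hP hGP)⟩
  | succ r ih =>
    obtain ⟨l, hl⟩ := ih
    set J : Ideal (MvPolynomial (Fin n) K) := Ideal.span (G ∪ Set.range (fun i => lin (l i))) with hJ
    have hfin : J.minimalPrimes.Finite := Ideal.finite_minimalPrimes_of_isNoetherianRing _ J
    set B : Set (Ideal (MvPolynomial (Fin n) K)) := {P ∈ J.minimalPrimes | ¬ ∀ i, X i ∈ P} with hB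
    have hBf : B.Finite := hfin.subset (fun _ h => h.1)
    let W : B → Submodule K (Fin n → K) := fun P => (P.1.restrictScalars K).comap lin
    have : Finite B := hBf
    have hne : ⋃ i, (W i : Set (Fin n → K)) ≠ Set.univ := by
      intro h
      obtain ⟨P, hP⟩ := Subspace.exists_eq_top_of_iUnion_eq_univ h
      apply P.2.2
      intro i
      have : Pi.single i (1:K) ∈ W P := by rw [hP]; trivial
      have h2 : lin (Pi.single i (1:K)) ∈ P.1 := this
      rwa [lin_single] at h2
    obtain ⟨v, hv⟩ := (Set.ne_univ_iff_exists_notMem _).1 hne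
    refine ⟨Fin.snoc l v, fun P hP hGP hlP => ?_⟩
    have hvP : lin v ∈ P := by simpa using hlP (Fin.last r)
    have hlP' : ∀ i, lin (l i) ∈ P := fun i => by simpa using hlP i.castSucc
    have hJP : J ≤ P := by
      rw [hJ, Ideal.span_le]
      rintro x (hx | ⟨i, rfl⟩)
      · exact hGP hx
      · exact hlP' i
    obtain ⟨Q, hQ, hQP⟩ := Ideal.exists_minimalPrimes_le hJP
    have := hQ.1.1
    have hJQ : J ≤ Q := hQ.1.2
    have hGQ : G ⊆ Q := fun x hx => hJQ (Ideal.subset_span (Or.inl hx))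
    have hlQ : ∀ i, lin (l i) ∈ Q := fun i => hJQ (Ideal.subset_span (Or.inr ⟨i, rfl⟩))
    by_cases hX : ∀ i, X i ∈ Q
    · exact Or.inl fun i => hQP (hX i)
    · right
      have hvQ : lin v ∉ Q := fun h => hv (Set.mem_iUnion.2 ⟨⟨Q, hQ, hX⟩, h⟩)
      have hlt : Q < P := lt_of_le_of_ne hQP (fun h => hvQ (h ▸ hvP))
      have h1 := (hl Q hQ.1.1 hGQ hlQ).resolve_left hX
      have h2 := Ideal.height_add_one_le_of_lt_of_isPrime hlt
      refine le_trans ?_ h2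
      have : ((c + (r+1) : ℕ) : ℕ∞) = ((c + r : ℕ) : ℕ∞) + 1 := by push_cast; ring
      rw [this]
      gcongr

attribute [local instance] MvPolynomial.gradedAlgebra

theorem span_X_eq {K : Type} [Field K] {n : ℕ} :
    Ideal.span (Set.range (X : Fin n → MvPolynomial (Fin n) K)) = RingHom.ker (constantCoeff (R := K)) := by
  apply le_antisymm
  · rw [Ideal.span_le]; rintro _ ⟨i, rfl⟩; simp
  · intro f hf
    have key : ∀ f : MvPolynomial (Fin n) K,
        f - C (constantCoeff f) ∈ Ideal.span (Set.range (X : Fin n → MvPolynomial (Fin n) K)) := by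
      intro f
      induction f using MvPolynomial.induction_on with
      | C a => simp
      | add p q hp hq =>
        have := add_mem hp hq
        simpa [add_sub_add_comm] using this
      | mul_X p i _ =>
        simpa using Ideal.mul_mem_left _ p (Ideal.subset_span (Set.mem_range_self i))
    have := key f
    rw [RingHom.mem_ker] at hf
    simpa [hf] using this

theorem height_vars_le {K : Type} [Field K] {n : ℕ} (P : Ideal (MvPolynomial (Fin n) K)) (_hP : P.IsPrime)
    (h : P ≤ Ideal.span (Set.range X)) : P.height ≤ n := by
  have hm : (Ideal.span (Set.range (X : Fin n → MvPolynomial (Fin n) K))) ≠ ⊤ := by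
    rw [Ideal.ne_top_iff_one]
    intro h1
    have : Ideal.span (Set.range (X : Fin n → MvPolynomial (Fin n) K)) ≤ RingHom.ker (constantCoeff (R := K)) := by
      rw [Ideal.span_le]; rintro _ ⟨i, rfl⟩; simp
    have := this h1
    simp at this
  refine (Ideal.height_mono h).trans ?_
  refine (Ideal.height_le_spanRank_toENat _ hm).trans ?_
  have := Submodule.spanRank_span_le_card (R := MvPolynomial (Fin n) K) (Set.range (X : Fin n → MvPolynomial (Fin n) K))
  have h3 : Cardinal.mk (Set.range (X : Fin n → MvPolynomial (Fin n) K)) ≤ n := by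
    simpa using Cardinal.mk_range_le (f := (X : Fin n → MvPolynomial (Fin n) K))
  have h4 := Cardinal.toENat.monotone' (this.trans h3)
  simpa using h4

theorem core_le {K : Type} [Field K] {n : ℕ} (P : Ideal (MvPolynomial (Fin n) K)) (hP : P ≠ ⊤) :
    (P.homogeneousCore (homogeneousSubmodule (Fin n) K)).toIdeal ≤ Ideal.span (Set.range X) := by
  rw [span_X_eq]
  intro f hf
  rw [RingHom.mem_ker]
  have h0 := MvPolynomial.homogeneousComponent_mem_of_mem (HomogeneousIdeal.isHomogeneous _) hf (n := 0)
  rw [homogeneousComponent_zero] at h0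
  have h1 := Ideal.toIdeal_homogeneousCore_le _ _ h0
  by_contra hne
  apply hP
  exact Ideal.eq_top_of_isUnit_mem _ h1 ((isUnit_iff_ne_zero.2 hne).map C)

theorem exA {k K : Type} [Field k] [Field K] [Infinite K] [Algebra k K] {n : ℕ} (d : ℕ) (hd : 1 ≤ d)
    (G : Set (MvPolynomial (Fin n) k)) (hG : ∀ g ∈ G, g.IsHomogeneous d) (c : ℕ)
    (hht : ∀ P : Ideal (MvPolynomial (Fin n) k), P.IsPrime → G ⊆ P → (c : ℕ∞) ≤ P.height) :
    ∃ A : Fin n → Fin c → K, ∀ (κ : Type) [Field κ] [Algebra K κ] (y : Fin c → κ),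
      (∀ f ∈ G, eval₂ ((algebraMap K κ).comp (algebraMap k K))
        (fun i => ∑ l, algebraMap K κ (A i l) * y l) f = 0) → y = 0 := by
  have hht' : ∀ P : Ideal (MvPolynomial (Fin n) K), P.IsPrime →
     (MvPolynomial.map (algebraMap k K)) '' G ⊆ P → (c : ℕ∞) ≤ P.height := by
    intro Q hQ hGQ
    let := MvPolynomial.algebraMvPolynomial (R := k) (S := K) (σ := Fin n)
    have : Module.Flat (MvPolynomial (Fin n) k) (MvPolynomial (Fin n) K) :=
      Module.Flat.isBaseChange k (MvPolynomial (Fin n) k) K (MvPolynomial (Fin n) K)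
        (Algebra.IsPushout.out (R := k) (S := MvPolynomial (Fin n) k) (R' := K)
          (S' := MvPolynomial (Fin n) K))
    have hGP : G ⊆ (Q.under (MvPolynomial (Fin n) k) : Ideal _) := fun g hg =>
      hGQ (Set.mem_image_of_mem _ hg)
    have hc := hht (Q.under _) inferInstance hGP
    obtain ⟨l, hl, hlen⟩ := Ideal.exists_ltSeries_length_eq_height (Q.under (MvPolynomial (Fin n) k))
    have hlo : Q.LiesOver l.last.asIdeal := by
      constructor; rw [hl]
    obtain ⟨L, hL1, hL2, -⟩ := Ideal.exists_ltSeries_of_hasGoingDown l Q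
    have h1 := Order.length_le_height_last (p := L)
    rw [hL2, ← PrimeSpectrum.height_eq_orderHeight, hL1, hlen] at h1
    exact hc.trans h1
  have hcn : c ≤ n := by
    have hpr : (RingHom.ker (constantCoeff (R := k) (σ := Fin n))).IsPrime := RingHom.ker_isPrime _
    have h1 := hht _ hpr (by
      intro g hg
      have := (hG g hg).coeff_eq_zero (d := 0) (by simp; omega)
      simpa [RingHom.mem_ker, constantCoeff_eq] using this)
    have h2 := height_vars_le _ hpr (by rw [span_X_eq])
    exact_mod_cast h1.trans h2
  obtain ⟨l, hl⟩ := exists_lin _ c hht' (n - c)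
  have hl' : ∀ P : Ideal (MvPolynomial (Fin n) K), P.IsPrime →
      (MvPolynomial.map (algebraMap k K)) '' G ⊆ P → (∀ i, lin (l i) ∈ P) → ∀ i, X i ∈ P := by
    intro P hP hGP hlP
    set Q := (P.homogeneousCore (homogeneousSubmodule (Fin n) K)).toIdeal with hQdef
    have hQP : Q ≤ P := Ideal.toIdeal_homogeneousCore_le _ _
    have hQ : Q.IsPrime := hP.homogeneousCore
    have hQm : Q ≤ Ideal.span (Set.range X) := core_le P hP.ne_top
    rcases hl Q hQ
      (by
        rintro _ ⟨g, hg, rfl⟩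
        exact Ideal.mem_homogeneousCore_of_homogeneous_of_mem
          ⟨d, (hG g hg).map _⟩ (hGP ⟨g, hg, rfl⟩))
      (fun i => Ideal.mem_homogeneousCore_of_homogeneous_of_mem ⟨1, lin_homog _⟩ (hlP i)) with h | h
    · exact fun i => hQP (h i)
    · have hm : (RingHom.ker (constantCoeff (R := K) (σ := Fin n))).IsPrime := RingHom.ker_isPrime _
      have hmn := height_vars_le _ hm (by rw [span_X_eq])
      rw [span_X_eq] at hQm
      have hQe : Q = RingHom.ker (constantCoeff (R := K) (σ := Fin n)) := by
        by_contra hne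
        have h2 := Ideal.height_add_one_le_of_lt_of_isPrime (lt_of_le_of_ne hQm hne)
        have h3 : ((c + (n - c) : ℕ) : ℕ∞) + 1 ≤ n := (by gcongr : _ ≤ Q.height + 1).trans (h2.trans hmn)
        rw [Nat.add_sub_cancel' hcn] at h3
        have h4 : n + 1 ≤ n := by exact_mod_cast h3
        omega
      intro i
      apply hQP
      rw [hQe, RingHom.mem_ker]; simp
  -- the linear subspace
  let T : (Fin n → K) →ₗ[K] (Fin (n - c) → K) := LinearMap.pi fun j => ∑ i, l j i • LinearMap.proj i
  have hT : ∀ v, T v = fun j => ∑ i, l j i * v i := by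
    intro v; ext j; simp [T]
  have hdim : c ≤ Module.finrank K (LinearMap.ker T) := by
    have h1 := T.finrank_range_add_finrank_ker
    have h2 : Module.finrank K (LinearMap.range T) ≤ n - c := by
      simpa using Submodule.finrank_le (LinearMap.range T)
    simp at h1
    omega
  have hli := (Module.finBasis K (LinearMap.ker T)).linearIndependent.comp (Fin.castLE hdim)
    (Fin.castLE_injective hdim)
  have hli2 := hli.map' (LinearMap.ker T).subtype (Submodule.ker_subtype _)
  set v : Fin c → (Fin n → K) := (LinearMap.ker T).subtype ∘
    ((Module.finBasis K (LinearMap.ker T)) ∘ (Fin.castLE hdim)) with hvdef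
  have hvT : ∀ a j, ∑ i, l j i * v a i = 0 := by
    intro a j
    have : T (v a) = 0 := ((Module.finBasis K (LinearMap.ker T)) (Fin.castLE hdim a)).2
    rw [hT] at this
    exact congrFun this j
  have hinj := linearIndependent_iff_injective_fintypeLinearCombination.1 hli2
  obtain ⟨g, hg⟩ := (Fintype.linearCombination K v).exists_leftInverse_of_injective
    (LinearMap.ker_eq_bot.2 hinj)
  refine ⟨fun i a => v a i, fun κ _ _ y hy => ?_⟩
  let ev : MvPolynomial (Fin n) K →+* κ := eval₂Hom (algebraMap K κ)
    (fun i => ∑ a, algebraMap K κ (v a i) * y a)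
  have hker := hl' (RingHom.ker ev) (RingHom.ker_isPrime _) (by
      rintro _ ⟨f, hf, rfl⟩
      have := hy f hf
      simp only [SetLike.mem_coe, RingHom.mem_ker, ev, coe_eval₂Hom, eval₂_map]
      exact this) (by
      intro j
      simp only [RingHom.mem_ker, ev, lin, LinearMap.coe_mk, AddHom.coe_mk, coe_eval₂Hom,
        eval₂_sum, eval₂_mul, eval₂_C, eval₂_X, Finset.mul_sum]
      rw [Finset.sum_comm]
      refine Finset.sum_eq_zero fun a _ => ?_
      have := congrArg (algebraMap K κ) (hvT a j)
      rw [map_sum, map_zero] at this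
      simp only [map_mul] at this
      simp only [← mul_assoc]
      rw [← Finset.sum_mul, this, zero_mul])
  have hker' : ∀ i, ∑ a, algebraMap K κ (v a i) * y a = 0 := by
    intro i
    have := hker i
    simpa [RingHom.mem_ker, ev] using this
  have hgv : ∀ a b, ∑ i, g (Pi.single i 1) b * v a i = if a = b then 1 else 0 := by
    intro a b
    have h1 := congrFun (LinearMap.congr_fun hg (Pi.single a 1)) b
    have h2 : v a = ∑ i, v a i • (Pi.single i (1:K) : Fin n → K) := by
      ext i; simp [Pi.single_apply]
    simp only [LinearMap.comp_apply, Fintype.linearCombination_apply_single, one_smul,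
      LinearMap.id_apply] at h1
    rw [h2, map_sum] at h1
    simp only [map_smul, Finset.sum_apply, Pi.smul_apply, smul_eq_mul] at h1
    rw [Pi.single_apply] at h1
    rw [eq_comm] at h1
    simp only [eq_comm (a := a), h1]
    exact Finset.sum_congr rfl fun i _ => mul_comm _ _
  ext b
  have h1 : ∑ i, algebraMap K κ (g (Pi.single i 1) b) * ∑ a, algebraMap K κ (v a i) * y a = 0 :=
    Finset.sum_eq_zero fun i _ => by rw [hker' i, mul_zero]
  simp only [Finset.mul_sum] at h1
  rw [Finset.sum_comm] at h1
  have h2 : ∀ a, ∑ i, algebraMap K κ (g (Pi.single i 1) b) * (algebraMap K κ (v a i) * y a)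
      = if a = b then y a else 0 := by
    intro a
    simp only [← mul_assoc, ← map_mul]
    rw [← Finset.sum_mul, ← map_sum, hgv]
    split_ifs <;> simp
  simp only [h2] at h1
  simpa using h1
end BCLB
namespace BCLB
open Function

section
variable {K : Type} [Field K] {m : ℕ}

theorem box_update {σ : Cht m} {l : Fin m} (h : σ l = none) (t : Bool) (N : Fin m → ℤ) :
    (box (update σ l (some t)) N : Submodule K (Lr K m)) ≤ box σ N := by
  intro f hf e he l'
  have h1 := hf e he l'
  by_cases hl : l' = l
  · subst hl; rw [h]; trivial
  · rwa [update_of_ne hl] at h1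

theorem dlt_mem {N : Fin m → ℤ} {x : Cht m → Lr K m} (hx : ∀ σ, x σ ∈ box σ N) (σ : Cht m) :
    dlt x σ ∈ box σ N := by
  unfold dlt
  refine Submodule.sum_mem _ fun l _ => ?_
  split_ifs with h
  · refine zsmul_mem (Submodule.sum_mem _ fun t _ => zsmul_mem (box_update h t N (hx _)) _) _
  · exact zero_mem _

theorem dlt_ne {W : Type*} [AddCommGroup W] {x : Cht m → W} {q : ℕ}
    (hx : ∀ σ, x σ ≠ 0 → nAB σ + 1 = q) (σ : Cht m) (h : dlt x σ ≠ 0) : nAB σ = q := by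
  unfold dlt at h
  obtain ⟨l, -, hl⟩ := Finset.exists_ne_zero_of_sum_ne_zero h
  split_ifs at hl with hn
  · have : ∑ t : Bool, eps t • x (update σ l (some t)) ≠ 0 := by
      intro h0; rw [h0] at hl; simp at hl
    obtain ⟨t, -, ht⟩ := Finset.exists_ne_zero_of_sum_ne_zero this
    have h2 := hx _ (fun h0 => ht (by rw [h0]; simp))
    have := nAB_update_some σ l t hn
    omega
  · exact absurd rfl hl

def dltL (K : Type) [Field K] {m : ℕ} (W : Type) [AddCommGroup W] [Module K W] :
    (Cht m → W) →ₗ[K] (Cht m → W) where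
  toFun := dlt
  map_add' := dlt_add
  map_smul' a x := by
    funext σ
    exact dlt_map (a • (LinearMap.id : W →ₗ[K] W)) x σ

theorem dlt_coord {ι : Type} (x : Cht m → ι → Lr K m) (g : ι) :
    dlt (fun σ => x σ g) = fun σ => dlt x σ g := by
  funext σ
  exact dlt_map (Pi.evalAddMonoidHom (fun _ : ι => Lr K m) g) x σ

structure Dat (K : Type) [Field K] (m : ℕ) (lam : Fin m → ℤ) where
  Gen : ℕ → Type
  deg : ∀ i, Gen i → ℤ
  D : ∀ i, (Gen (i+1) → Lr K m) →ₗ[K] (Gen i → Lr K m)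
  H : Cht m → ∀ i, (Gen i → Lr K m) →ₗ[K] (Gen (i+1) → Lr K m)
  DD : ∀ i x, D i (D (i+1) x) = 0
  DH0 : ∀ σ x, D 0 (H σ 0 x) = x
  DH : ∀ σ i x, D (i+1) (H σ (i+1) x) + H σ i (D i x) = x
  Dbox : ∀ σ i x, (∀ g, x g ∈ box σ (fun l => lam l - 1 - deg (i+1) g)) →
    ∀ g, D i x g ∈ box σ (fun l => lam l - 1 - deg i g)
  Hbox : ∀ σ i x, (∀ g, x g ∈ box σ (fun l => lam l - 1 - deg i g)) →
    ∀ g, H σ i x g ∈ box σ (fun l => lam l - 1 - deg (i+1) g)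
  hdeg : ∀ i, i ≤ m + 1 → ∀ g : Gen i, ∀ l : Fin m, l.val + 1 ≤ i → lam l ≤ deg i g

namespace Dat
variable {lam : Fin m → ℤ} (T : Dat K m lam)

abbrev X (i : ℕ) := Cht m → T.Gen i → Lr K m

noncomputable def HX (i : ℕ) : T.X i →ₗ[K] T.X (i+1) where
  toFun x σ := T.H σ i (x σ)
  map_add' x y := by funext σ; simp
  map_smul' a x := by funext σ; simp

noncomputable def DX (i : ℕ) (x : T.X (i+1)) : T.X i := fun σ => T.D i (x σ)

theorem DX_dlt (i : ℕ) (x : T.X (i+1)) : T.DX i (dlt x) = dlt (T.DX i x) := by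
  funext σ; exact (dlt_map (T.D i) x σ).symm

noncomputable def W : ∀ i, T.X 0 →ₗ[K] T.X (i+1)
  | 0 => T.HX 0
  | i+1 => T.HX (i+1) ∘ₗ dltL K _ ∘ₗ W i

theorem W_succ (i : ℕ) (z : T.X 0) : T.W (i+1) z = T.HX (i+1) (dlt (T.W i z)) := rfl

def V (i q : ℕ) (x : T.X i) : Prop :=
  (∀ σ g, x σ g ∈ box σ (fun l => lam l - 1 - T.deg i g)) ∧ ∀ σ, x σ ≠ 0 → nAB σ + 1 = q

theorem V_dlt {i q : ℕ} {x : T.X i} (h : T.V i q x) : T.V i (q+1) (dlt x) := by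
  refine ⟨fun σ g => ?_, fun σ hσ => ?_⟩
  · have := dlt_mem (x := fun σ => x σ g) (N := fun l => lam l - 1 - T.deg i g) (fun σ => h.1 σ g) σ
    rwa [dlt_coord] at this
  · rw [dlt_ne h.2 σ hσ]

theorem V_HX {i q : ℕ} {x : T.X i} (h : T.V i q x) : T.V (i+1) q (T.HX i x) := by
  refine ⟨fun σ => T.Hbox σ i _ (h.1 σ), fun σ hσ => h.2 σ ?_⟩
  intro h0; apply hσ; show T.H σ i (x σ) = 0; rw [h0, map_zero]

theorem V_DX {i q : ℕ} {x : T.X (i+1)} (h : T.V (i+1) q x) : T.V i q (T.DX i x) := by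
  refine ⟨fun σ => T.Dbox σ i _ (h.1 σ), fun σ hσ => h.2 σ ?_⟩
  intro h0; apply hσ; show T.D i (x σ) = 0; rw [h0, map_zero]

theorem V_sub {i q : ℕ} {x y : T.X i} (h : T.V i q x) (h' : T.V i q y) : T.V i q (x - y) := by
  refine ⟨fun σ g => sub_mem (h.1 σ g) (h'.1 σ g), fun σ hσ => ?_⟩
  by_cases hx : x σ = 0
  · apply h'.2; intro hy; apply hσ; simp [hx, hy]
  · exact h.2 σ hx

theorem V_W {z : T.X 0} (hz : T.V 0 1 z) (i : ℕ) : T.V (i+1) (i+1) (T.W i z) := by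
  induction i with
  | zero => exact T.V_HX hz
  | succ i ih => rw [W_succ]; exact T.V_HX (T.V_dlt ih)

theorem D_W0 (z : T.X 0) : T.DX 0 (T.W 0 z) = z := by
  funext σ; exact T.DH0 σ _

theorem D_W {z : T.X 0} (hz : dlt z = 0) (i : ℕ) : T.DX (i+1) (T.W (i+1) z) = dlt (T.W i z) := by
  have key : ∀ i, T.DX i (dlt (T.W i z)) = 0 → T.DX (i+1) (T.W (i+1) z) = dlt (T.W i z) := by
    intro i h
    funext σ
    have := T.DH σ i (dlt (T.W i z) σ)
    have h2 : T.D i (dlt (T.W i z) σ) = 0 := congrFun h σ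
    rw [h2, map_zero, add_zero] at this
    exact this
  apply key
  induction i with
  | zero => rw [DX_dlt, D_W0, hz]
  | succ i ih => rw [DX_dlt, key i ih, dlt_dlt]

theorem vanishX {i q : ℕ} {y : T.X i} (hy : T.V i q y) (hd : dlt y = 0)
    (hE : ∀ e σ g, cf e (y σ g) ≠ 0 → ∃ l t, Ok (some t) (lam l - 1 - T.deg i g) (e l) ∧
      ¬ Ok (some !t) (lam l - 1 - T.deg i g) (e l)) :
    ∃ u : T.X i, (∀ σ g, u σ g ∈ box σ (fun l => lam l - 1 - T.deg i g)) ∧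
      (∀ σ, u σ ≠ 0 → nAB σ + 1 + 1 = q) ∧ dlt u = y := by
  have := fun g => vanish (fun l => lam l - 1 - T.deg i g) q (fun σ => y σ g) (fun σ => hy.1 σ g)
    (fun σ h => hy.2 σ (fun h0 => h (by rw [h0]; rfl))) (by rw [dlt_coord, hd]; rfl)
    (fun e σ h => hE e σ g h)
  choose u h1 h2 h3 using this
  refine ⟨fun σ g => u g σ, fun σ g => h1 g σ, ?_, ?_⟩
  · intro σ h
    obtain ⟨g, hg⟩ := Function.ne_iff.1 h
    exact h2 g σ hg
  · funext σ g
    have := congrFun (dlt_coord (fun σ g => u g σ) g) σ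
    rw [← this]
    exact congrFun (h3 g) σ

theorem nAB_le (σ : Cht m) : nAB σ ≤ m := by
  unfold nAB; exact (Finset.card_le_univ _).trans (by simp)

theorem descend {z : T.X 0} (hz : T.V 0 1 z) (hdz : dlt z = 0)
    (hP : ∀ g e, (∀ l, lam l - 1 - T.deg (m+1) g < e l ∧ e l < 0) →
      cf e (T.W m z (fun _ => none) g) = 0) : z = 0 := by
  have main : ∀ j, j ≤ m → ∃ u : T.X (m - j + 1), T.V (m-j+1) (m-j) u ∧
      T.DX (m-j) (T.W (m-j) z) = T.DX (m-j) (dlt u) := by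
    intro j
    induction j with
    | zero =>
      intro _
      have hV := T.V_W hz m
      obtain ⟨u, hu1, hu2, hu3⟩ := T.vanishX hV (by
        funext σ
        by_contra h
        have := dlt_ne hV.2 σ h
        have := nAB_le σ
        omega) (by
        intro e σ g he
        have hσ : nAB σ + 1 = m + 1 := hV.2 σ (by intro h; apply he; rw [h]; simp)
        have hσ' : σ = fun _ => none := by
          funext l
          have h2 : (Finset.univ.filter (fun l => σ l = none)) = Finset.univ := by
            apply Finset.eq_univ_of_card; unfold nAB at hσ; simp; omega
          have := Finset.mem_univ l
          rw [← h2] at this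
          simpa using this
        subst hσ'
        by_contra hcon
        apply he
        apply hP g e
        intro l
        have hl := T.hdeg (m+1) le_rfl g l (by omega)
        push Not at hcon
        have a1 := hcon l true
        have a2 := hcon l false
        simp only [Ok, Bool.not_true, Bool.not_false] at a1 a2
        constructor
        · by_contra hh
          have := a1 (by omega); omega
        · by_contra hh
          have := a2 (by omega); omega)
      exact ⟨u, ⟨hu1, fun σ h => by have := hu2 σ h; omega⟩, by simp only [Nat.sub_zero]; rw [hu3]⟩
    | succ j ih =>
      intro hj
      obtain ⟨i, hi⟩ : ∃ i, m - j = i + 1 := ⟨m - j - 1, by omega⟩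
      have hi' : m - (j+1) = i := by omega
      have ih := ih (by omega)
      rw [hi] at ih
      rw [hi']
      obtain ⟨u, hu, hDu⟩ := ih
      rw [T.D_W hdz] at hDu
      have hV : T.V (i+1) (i+1) (T.W i z - T.DX (i+1) u) := T.V_sub (T.V_W hz i) (T.V_DX hu)
      obtain ⟨v, hv1, hv2, hv3⟩ := T.vanishX hV (by
        have : dlt (T.W i z - T.DX (i+1) u) = dlt (T.W i z) - dlt (T.DX (i+1) u) :=
          map_sub (dltL K _) _ _
        rw [this, hDu, DX_dlt, sub_self]) (by
        intro e σ g he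
        have hσ : nAB σ + 1 = i + 1 := hV.2 σ (by intro h; apply he; rw [h]; simp)
        have hex : ∃ l : Fin m, l.val + 1 ≤ i + 1 ∧ σ l ≠ none := by
          by_contra hcon
          push Not at hcon
          have hsub : (Finset.univ.filter (fun l : Fin m => l.val < i+1)) ⊆
              Finset.univ.filter (fun l => σ l = none) := by
            intro l hl
            simp only [Finset.mem_filter, Finset.mem_univ, true_and] at hl ⊢
            exact hcon l (by omega)
          have h1 := Finset.card_le_card hsub
          have h2 : (Finset.univ.filter (fun l : Fin m => l.val < i+1)).card = i + 1 := by
            rw [Fin.card_filter_val_lt]; omega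
          unfold nAB at hσ
          omega
        obtain ⟨l, hl, hn⟩ := hex
        obtain ⟨t, ht⟩ := Option.ne_none_iff_exists'.1 hn
        have h1 := T.hdeg (i+1) (by omega) g l hl
        have h2 := hV.1 σ g e he l
        rw [ht] at h2
        refine ⟨l, t, h2, ?_⟩
        cases t
        · simp only [Ok, Bool.not_false] at h2 ⊢; omega
        · simp only [Ok, Bool.not_true] at h2 ⊢; omega)
      refine ⟨v, ⟨hv1, fun σ h => by have := hv2 σ h; omega⟩, ?_⟩
      rw [hv3]
      funext σ
      show T.D i (T.W i z σ) = T.D i (T.W i z σ - T.D (i+1) (u σ))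
      rw [map_sub, T.DD, sub_zero]
  have hm := main m le_rfl
  rw [Nat.sub_self] at hm
  obtain ⟨u, hu, h⟩ := hm
  have hu0 : u = 0 := by
    funext σ
    by_contra hh
    have := hu.2 σ hh
    omega
  rw [D_W0, hu0] at h
  have h1 : dlt (0 : T.X (0+1)) = 0 := map_zero (dltL K _)
  rw [h1] at h
  rw [h]
  funext σ
  exact map_zero (T.D 0)

open Classical in
noncomputable def src (g0 : T.Gen 0) (lam : Fin m → ℤ) :
    ((Fintype.piFinset fun l => Finset.Ico 0 (lam l)) → K) →ₗ[K] T.X 0 where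
  toFun f σ g := if nAB σ = 0 ∧ g = g0 then ∑ e, f e • AddMonoidAlgebra.single e.1 1 else 0
  map_add' f f' := by
    funext σ g
    simp only [Pi.add_apply]
    split_ifs
    · simp only [add_smul, Finset.sum_add_distrib]
    · simp
  map_smul' a f := by
    funext σ g
    simp only [Pi.smul_apply, RingHom.id_apply]
    split_ifs
    · simp only [Finset.smul_sum, smul_smul, smul_eq_mul]
    · simp

theorem src_dlt (g0 : T.Gen 0) (f) : dlt (T.src g0 lam f) = 0 := by
  funext σ
  unfold dlt
  refine Finset.sum_eq_zero fun l _ => ?_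
  split_ifs with h
  · have : T.src g0 lam f (update σ l (some true)) = T.src g0 lam f (update σ l (some false)) := by
      funext g
      have h1 := nAB_update_some σ l true h
      have h2 := nAB_update_some σ l false h
      have h3 : nAB (update σ l (some true)) = nAB (update σ l (some false)) := by omega
      simp only [src, LinearMap.coe_mk, AddHom.coe_mk]
      congr 1
      rw [h3]
    simp [this, eps]
  · rfl

theorem src_V (g0 : T.Gen 0) (hg0 : T.deg 0 g0 = 0) (f) : T.V 0 1 (T.src g0 lam f) := by
  refine ⟨fun σ g => ?_, fun σ h => ?_⟩
  · simp only [src, LinearMap.coe_mk, AddHom.coe_mk]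
    split_ifs with h
    · refine Submodule.sum_mem _ fun e _ => Submodule.smul_mem _ _ (single_mem_box fun l => ?_)
      have := Fintype.mem_piFinset.1 e.2 l
      rw [Finset.mem_Ico] at this
      rw [h.2, hg0]
      rcases σ l with _ | _ | _
      · trivial
      · exact this.1
      · simp only [Ok]; omega
    · exact zero_mem _
  · by_contra hcon
    apply h
    funext g
    simp only [src, LinearMap.coe_mk, AddHom.coe_mk]
    rw [if_neg]
    · rfl
    · omega

theorem src_inj (g0 : T.Gen 0) (f) (h : T.src g0 lam f = 0) : f = 0 := by
  have h1 := congrFun (congrFun h (fun _ => some true)) g0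
  simp only [src, LinearMap.coe_mk, AddHom.coe_mk] at h1
  rw [if_pos ⟨by simp [nAB], by trivial⟩] at h1
  funext e
  have h2 := congrArg (cf e.1) h1
  rw [map_sum] at h2
  rw [Finset.sum_eq_single e] at h2
  · simpa [cf_apply, AddMonoidAlgebra.coeff_single] using h2
  · intro e' _ hne
    have : e'.1 ≠ e.1 := fun h => hne (Subtype.ext h)
    simp [cf_apply, AddMonoidAlgebra.coeff_single, this]
  · simp

theorem count [Fintype (T.Gen (m+1))] (hlam : ∀ l, 1 ≤ lam l) (g0 : T.Gen 0) (hg0 : T.deg 0 g0 = 0) :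
    ∏ l, lam l ≤ ∑ g : T.Gen (m+1), ∏ l, (T.deg (m+1) g - lam l) := by
  let E1 := (g : T.Gen (m+1)) × (Fintype.piFinset fun l => Finset.Ioo (lam l - 1 - T.deg (m+1) g) 0)
  let tgt : T.X (m+1) →ₗ[K] (E1 → K) :=
    { toFun := fun x e => cf e.2.1 (x (fun _ => none) e.1)
      map_add' := fun x y => by funext e; simp
      map_smul' := fun a x => by funext e; simp }
  let F := tgt ∘ₗ T.W m ∘ₗ T.src g0 lam
  have hF : Injective F := by
    rw [injective_iff_map_eq_zero]
    intro f hf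
    apply T.src_inj g0
    apply T.descend (T.src_V g0 hg0 f) (T.src_dlt g0 f)
    intro g e he
    exact congrFun hf ⟨g, ⟨e, Fintype.mem_piFinset.2 fun l => Finset.mem_Ioo.2 (he l)⟩⟩
  have h := LinearMap.finrank_le_finrank_of_injective hF
  rw [Module.finrank_fintype_fun_eq_card, Module.finrank_fintype_fun_eq_card] at h
  rw [Fintype.card_sigma] at h
  simp only [Fintype.card_coe, Fintype.card_piFinset, Int.card_Ico, Int.card_Ioo] at h
  zify at h
  convert h using 1
  · refine Finset.prod_congr rfl fun l _ => ?_
    have := hlam l; omega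
  · refine Finset.sum_congr rfl fun g _ => Finset.prod_congr rfl fun l _ => ?_
    have := T.hdeg (m+1) le_rfl g l (by omega); omega

end Dat
end
end BCLB
namespace BCLB
open Function

section
variable {k : Type} [Field k] {n : ℕ}

def HomD (D : ℤ) (f : MvPolynomial (Fin n) k) : Prop :=
  f = 0 ∨ ∃ m : ℕ, (m : ℤ) = D ∧ f.IsHomogeneous m

noncomputable def hc (D : ℤ) : MvPolynomial (Fin n) k →ₗ[k] MvPolynomial (Fin n) k :=
  if 0 ≤ D then MvPolynomial.homogeneousComponent D.toNat else 0

theorem hc_homD (D : ℤ) (f : MvPolynomial (Fin n) k) : HomD D (hc D f) := by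
  unfold hc
  split_ifs with h
  · right
    exact ⟨D.toNat, by omega, MvPolynomial.homogeneousComponent_isHomogeneous _ _⟩
  · left; rfl

theorem hc_of {D : ℤ} {f : MvPolynomial (Fin n) k} (h : HomD D f) : hc D f = f := by
  rcases h with rfl | ⟨m, rfl, h⟩
  · simp
  · simp [hc, MvPolynomial.homogeneousComponent_of_mem h]

theorem hc_of_ne {D : ℤ} {f : MvPolynomial (Fin n) k} {m : ℕ} (h : f.IsHomogeneous m) (hne : (m : ℤ) ≠ D) :
    hc D f = 0 := by
  unfold hc
  split_ifs with hD
  · rw [MvPolynomial.homogeneousComponent_of_mem h, if_neg]; omega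
  · rfl

theorem hc_mul {a : ℤ} {f : MvPolynomial (Fin n) k} (h : HomD a f) (b : ℤ) (x : MvPolynomial (Fin n) k) :
    hc (b + a) (x * f) = hc b x * f := by
  rcases h with rfl | ⟨m, rfl, h⟩
  · simp
  · rw [← MvPolynomial.sum_homogeneousComponent x, Finset.sum_mul, map_sum, map_sum, Finset.sum_mul]
    refine Finset.sum_congr rfl fun i _ => ?_
    have h1 := MvPolynomial.homogeneousComponent_isHomogeneous i x
    have h2 := h1.mul h
    by_cases hi : (i : ℤ) = b
    · rw [hc_of (D := b) (Or.inr ⟨i, hi, h1⟩), hc_of (Or.inr ⟨i + m, by push_cast; omega, h2⟩)]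
    · rw [hc_of_ne h1 hi, hc_of_ne h2 (by push_cast; omega), zero_mul]

theorem HomD.mul {a b : ℤ} {f g : MvPolynomial (Fin n) k} (hf : HomD a f) (hg : HomD b g) :
    HomD (a + b) (f * g) := by
  rw [← hc_of hf, ← hc_mul hg]; exact hc_homD _ _

theorem HomD.sub {a : ℤ} {f g : MvPolynomial (Fin n) k} (hf : HomD a f) (hg : HomD a g) :
    HomD a (f - g) := by
  rw [← hc_of hf, ← hc_of hg, ← map_sub]; exact hc_homD _ _

theorem HomD.sum {ι : Type*} (s : Finset ι) {a : ℤ} {f : ι → MvPolynomial (Fin n) k}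
    (hf : ∀ i ∈ s, HomD a (f i)) : HomD a (∑ i ∈ s, f i) := by
  rw [← Finset.sum_congr rfl fun i hi => hc_of (hf i hi), ← map_sum]; exact hc_homD _ _

theorem lin_expand {A : Type*} [CommRing A] {ι κ : Type*} [Fintype ι] (f : (ι →₀ A) →ₗ[A] (κ →₀ A))
    (x : ι →₀ A) (g' : κ) : f x g' = ∑ g, x g * f (Finsupp.single g 1) g' := by
  classical
  have : x = ∑ g, x g • Finsupp.single g (1 : A) := by
    ext g
    simp [Finsupp.finsetSum_apply, Finsupp.single_apply]
  conv_lhs => rw [this]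
  simp only [map_sum, map_smul, Finsupp.finsetSum_apply, Finsupp.smul_apply, smul_eq_mul]

abbrev GenT (b : ℤ → ℕ) := (j : ℤ) × Fin (b j)

theorem genFinite {b : ℤ → ℕ} (h : (Function.support b).Finite) : Finite (GenT b) := by
  have := h.to_subtype
  have hs : Finite ((j : Function.support b) × Fin (b j)) := inferInstance
  refine Finite.of_injective (β := (j : Function.support b) × Fin (b j))
    (fun g => ⟨⟨g.1, fun h0 => by have := g.2.2; omega⟩, g.2⟩) ?_
  rintro ⟨j, a⟩ ⟨j', a'⟩ hh
  have h1 : j = j' := congrArg (fun g => g.1.1) hh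
  subst h1
  simpa using hh

variable {I : Ideal (MvPolynomial (Fin n) k)}

abbrev Res (I : Ideal (MvPolynomial (Fin n) k)) := MinGradedFreeRes (MvPolynomial (Fin n) k)
      (fun m => {f | MvPolynomial.IsHomogeneous f m}) (MvPolynomial (Fin n) k ⧸ I)

noncomputable instance (res : Res I) (i : ℕ) : Fintype (GenT (res.β i)) :=
  @Fintype.ofFinite _ (genFinite (res.finβ i))

theorem d_hom (res : Res I) (i : ℕ) (g : GenT (res.β (i+1))) (g' : GenT (res.β i)) :
    HomD (g.1 - g'.1) (res.d i (Finsupp.single g 1) g') := res.graded i g.1 g.2 g'.1 g'.2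

theorem lift_hom (res : Res I) (i : ℕ) (j : ℤ) (y : FreeMod (MvPolynomial (Fin n) k) (res.β i))
    (hy : ∀ g, HomD (j - g.1) (y g)) (hr : y ∈ LinearMap.range (res.d i)) :
    ∃ x : FreeMod (MvPolynomial (Fin n) k) (res.β (i+1)),
      (∀ g, HomD (j - g.1) (x g)) ∧ res.d i x = y := by
  obtain ⟨x, rfl⟩ := hr
  refine ⟨Finsupp.equivFunOnFinite.symm fun g => hc (j - g.1) (x g), fun g => hc_homD _ _, ?_⟩
  ext1 g'
  rw [← hc_of (hy g'), lin_expand, lin_expand (res.d i) x, map_sum]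
  refine Finset.sum_congr rfl fun g _ => ?_
  rw [Finsupp.equivFunOnFinite_symm_apply_apply, ← hc_mul (d_hom res i g g')]
  congr 2; ring

/-- homotopy condition at stage `i` -/
def HomoP (res : Res I) (a : MvPolynomial (Fin n) k) (d : ℕ) (i : ℕ)
    (h : FreeMod (MvPolynomial (Fin n) k) (res.β i) →ₗ[MvPolynomial (Fin n) k]
      FreeMod (MvPolynomial (Fin n) k) (res.β (i+1))) : Prop :=
  (∀ g g', HomD (g.1 + d - g'.1) (h (Finsupp.single g 1) g')) ∧
  ∀ x, res.d i (h (res.d i x)) = a • res.d i x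

theorem build (res : Res I) (i : ℕ) (d : ℕ)
    (f : FreeMod (MvPolynomial (Fin n) k) (res.β i) →ₗ[MvPolynomial (Fin n) k]
      FreeMod (MvPolynomial (Fin n) k) (res.β i))
    (hf : ∀ g g', HomD (g.1 + d - g'.1) (f (Finsupp.single g 1) g'))
    (hr : ∀ x, f x ∈ LinearMap.range (res.d i)) :
    ∃ h : FreeMod (MvPolynomial (Fin n) k) (res.β i) →ₗ[MvPolynomial (Fin n) k]
      FreeMod (MvPolynomial (Fin n) k) (res.β (i+1)),
      (∀ g g', HomD (g.1 + d - g'.1) (h (Finsupp.single g 1) g')) ∧ ∀ x, res.d i (h x) = f x := by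
  choose H h1 h2 using fun g => lift_hom res i (g.1 + d) (f (Finsupp.single g 1)) (hf g) (hr _)
  refine ⟨Finsupp.linearCombination _ H, ?_, ?_⟩
  · intro g g'
    simpa using h1 g g'
  · intro x
    have : res.d i ∘ₗ Finsupp.linearCombination _ H = f := by
      apply Finsupp.lhom_ext'
      intro g
      apply LinearMap.ext_ring
      simp [h2]
    exact LinearMap.congr_fun this x

theorem smul_single_hom (res : Res I) (a : MvPolynomial (Fin n) k) (d : ℕ) (ha : a.IsHomogeneous d) (i : ℕ)
    (g g' : GenT (res.β i)) : HomD (g.1 + d - g'.1) ((a • Finsupp.single g (1 : MvPolynomial (Fin n) k)) g') := by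
  classical
  by_cases h : g = g'
  · subst h
    right
    exact ⟨d, by ring, by simpa using ha⟩
  · left; simp [h]

theorem step0 (res : Res I) (a : MvPolynomial (Fin n) k) (d : ℕ) (ha : a.IsHomogeneous d) (haI : a ∈ I) :
    ∃ h : FreeMod (MvPolynomial (Fin n) k) (res.β 0) →ₗ[MvPolynomial (Fin n) k]
      FreeMod (MvPolynomial (Fin n) k) (res.β (0+1)),
      HomoP res a d 0 h ∧ ∀ x, res.d 0 (h x) = a • x := by
  obtain ⟨h, h1, h2⟩ := build res 0 d (a • (LinearMap.id : FreeMod (MvPolynomial (Fin n) k) (res.β 0) →ₗ[MvPolynomial (Fin n) k] _)) (fun g g' => smul_single_hom res a d ha 0 g g') (by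
    intro x
    rw [res.exact₀, LinearMap.mem_ker, LinearMap.smul_apply, map_smul, LinearMap.id_apply]
    obtain ⟨y, hy⟩ := Submodule.mkQ_surjective I (res.aug x)
    rw [← hy, ← map_smul (Submodule.mkQ I) a y] 
    exact (Submodule.Quotient.mk_eq_zero I).2 (I.mul_mem_right y haI))
  exact ⟨h, ⟨h1, fun x => h2 _⟩, h2⟩

theorem d_comp (res : Res I) (i : ℕ) (x) : res.d i (res.d (i+1) x) = 0 := by
  have : res.d (i+1) x ∈ LinearMap.range (res.d (i+1)) := ⟨x, rfl⟩
  rw [res.exact i] at this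
  exact this

theorem stepS (res : Res I) (a : MvPolynomial (Fin n) k) (d : ℕ) (ha : a.IsHomogeneous d) (i : ℕ) (h)
    (hh : HomoP res a d i h) :
    ∃ h', HomoP res a d (i+1) h' ∧ ∀ x, res.d (i+1) (h' x) + h (res.d i x) = a • x := by
  obtain ⟨h', h1, h2⟩ := build res (i+1) d (a • LinearMap.id - h ∘ₗ res.d i) (by
    intro g g'
    refine (smul_single_hom res a d ha (i+1) g g').sub ?_
    rw [LinearMap.comp_apply, lin_expand h]
    refine HomD.sum _ fun g'' _ => ?_
    have := (d_hom res i g g'').mul (hh.1 g'' g')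
    convert this using 1
    ring) (by
    intro x
    rw [res.exact i, LinearMap.mem_ker]
    simp [hh.2])
  have h3 : ∀ x, res.d (i+1) (h' x) + h (res.d i x) = a • x := by
    intro x; rw [h2]; simp
  refine ⟨h', ⟨h1, fun x => ?_⟩, h3⟩
  have := h3 (res.d (i+1) x)
  rwa [d_comp, map_zero, add_zero] at this

theorem exists_homotopy (res : Res I) (a : MvPolynomial (Fin n) k) (d : ℕ) (ha : a.IsHomogeneous d) (haI : a ∈ I) :
    ∃ h : ∀ i, FreeMod (MvPolynomial (Fin n) k) (res.β i) →ₗ[MvPolynomial (Fin n) k]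
      FreeMod (MvPolynomial (Fin n) k) (res.β (i+1)),
      (∀ i g g', HomD (g.1 + d - g'.1) (h i (Finsupp.single g 1) g')) ∧
      (∀ x, res.d 0 (h 0 x) = a • x) ∧
      ∀ i x, res.d (i+1) (h (i+1) x) + h i (res.d i x) = a • x := by
  choose h0 h01 h02 using step0 res a d ha haI
  choose F hF1 hF2 using stepS res a d ha
  let s : ∀ i, {h // HomoP res a d i h} := fun i => Nat.rec ⟨h0, h01⟩ (fun i t => ⟨F i t.1 t.2, hF1 i t.1 t.2⟩) i
  exact ⟨fun i => (s i).1, fun i => (s i).2.1, h02, fun i => hF2 i (s i).1 (s i).2⟩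

section bc
variable {A L : Type} [CommRing A] [CommRing L] (φ : A →+* L) {ι κ μ : Type} [Fintype ι] [Fintype κ] [Fintype μ]

noncomputable def bc (f : (ι →₀ A) →ₗ[A] (κ →₀ A)) (x : ι → L) : κ → L :=
  fun g' => ∑ g, φ (f (Finsupp.single g 1) g') * x g

theorem bc_comp (f : (κ →₀ A) →ₗ[A] (μ →₀ A)) (e : (ι →₀ A) →ₗ[A] (κ →₀ A)) (x : ι → L) :
    bc φ f (bc φ e x) = bc φ (f ∘ₗ e) x := by
  funext g
  simp only [bc, LinearMap.comp_apply, Finset.mul_sum]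
  rw [Finset.sum_comm]
  refine Finset.sum_congr rfl fun i _ => ?_
  rw [lin_expand f, map_sum, Finset.sum_mul]
  refine Finset.sum_congr rfl fun j _ => ?_
  rw [map_mul]; ring

theorem bc_add (f e : (ι →₀ A) →ₗ[A] (κ →₀ A)) (x : ι → L) :
    bc φ (f + e) x = bc φ f x + bc φ e x := by
  funext g
  simp [bc, add_mul, Finset.sum_add_distrib]

theorem bc_zero (x : ι → L) : bc φ (0 : (ι →₀ A) →ₗ[A] (κ →₀ A)) x = 0 := by
  funext g
  simp [bc]

theorem bc_smul_id (a : A) (x : ι → L) : bc φ (a • (LinearMap.id : (ι →₀ A) →ₗ[A] (ι →₀ A))) x = φ a • x := by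
  classical
  funext g
  simp only [bc, LinearMap.smul_apply, LinearMap.id_apply, Finsupp.smul_apply, Pi.smul_apply, smul_eq_mul]
  rw [Finset.sum_eq_single g]
  · simp
  · intro b _ h; simp [h]
  · simp
end bc

end
end BCLB
namespace BCLB
open Function

section
variable {k : Type} [Field k] {n : ℕ} {I : Ideal (MvPolynomial (Fin n) k)}
variable {K : Type} [Field K] [Algebra k K] {m : ℕ}

theorem phi_homD (σ : Cht m) (A : Fin n → Fin (m+1) → K) {D : ℤ} {f : MvPolynomial (Fin n) k}
    (hf : HomD D f) : phi A f ∈ box σ (fun _ => D) := by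
  rcases hf with rfl | ⟨N, rfl, h⟩
  · rw [map_zero]; exact zero_mem _
  · exact phi_mem σ A f N h

noncomputable def bcL {A L : Type} [CommRing A] [CommRing L] [Algebra K L] (φ : A →+* L) {ι κ : Type}
    [Fintype ι] (f : (ι →₀ A) →ₗ[A] (κ →₀ A)) : (ι → L) →ₗ[K] (κ → L) where
  toFun := bc φ f
  map_add' x y := by funext g; simp [bc, mul_add, Finset.sum_add_distrib]
  map_smul' a x := by funext g; simp [bc, Finset.smul_sum]

theorem bc_box (σ : Cht m) (A : Fin n → Fin (m+1) → K) {ι κ : Type} [Fintype ι]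
    (f : (ι →₀ MvPolynomial (Fin n) k) →ₗ[MvPolynomial (Fin n) k] (κ →₀ MvPolynomial (Fin n) k))
    (a : ι → ℤ) (b : κ → ℤ) (s : ℤ) (lam : Fin m → ℤ)
    (hf : ∀ g g', HomD (a g + s - b g') (f (Finsupp.single g 1) g'))
    (x : ι → Lr K m) (hx : ∀ g, x g ∈ box σ (fun l => lam l - 1 - a g)) (g' : κ) :
    bc (phi A) f x g' ∈ box σ (fun l => lam l - 1 - b g' + s) := by
  refine Submodule.sum_mem _ fun g _ => ?_
  refine box_congr ?_ (mul_mem_box (phi_homD σ A (hf g g')) (hx g))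
  intro l _
  simp only [Pi.add_apply]; ring

theorem bc_smul_lin {A L : Type} [CommRing A] [CommRing L] (φ : A →+* L) {ι κ τ : Type} [Fintype ι]
    (f : (ι →₀ A) →ₗ[A] (κ →₀ A)) (s : Finset τ) (r : τ → L) (x : τ → ι → L) :
    bc φ f (∑ t ∈ s, r t • x t) = ∑ t ∈ s, r t • bc φ f (x t) := by
  funext g
  simp only [bc, Finset.sum_apply, Pi.smul_apply, smul_eq_mul, Finset.mul_sum]
  rw [Finset.sum_comm]
  refine Finset.sum_congr rfl fun t _ => Finset.sum_congr rfl fun i _ => ?_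
  ring

theorem main_ineq (res : Res I) (G : Set (MvPolynomial (Fin n) k)) (d : ℕ) (hd : 1 ≤ d)
    (hG : ∀ g ∈ G, g.IsHomogeneous d) (hGI : Ideal.span G = I) (m : ℕ)
    (hht : ∀ P : Ideal (MvPolynomial (Fin n) k), P.IsPrime → G ⊆ P → ((m + 1 : ℕ) : ℕ∞) ≤ P.height)
    (h0 : res.β 0 0 ≠ 0)
    (lam : Fin m → ℤ) (hlam : ∀ l, 1 ≤ lam l)
    (hdeg : ∀ i, i ≤ m + 1 → ∀ j, res.β i j ≠ 0 → ∀ l : Fin m, l.val + 1 ≤ i → lam l ≤ j) :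
    ∏ l, lam l ≤ ∑ g : GenT (res.β (m+1)), ∏ l, (g.1 - lam l) := by
  let K := AlgebraicClosure k
  haveI : Infinite K := IsAlgClosed.instInfinite
  obtain ⟨A, hA⟩ := exA (k := k) (K := K) d hd G hG (m+1) hht
  choose N a r ha hr hsum using fun σ : Cht m => exists_unit σ A d G hG hA
  choose h hh1 hh2 hh3 using fun (σ : Cht m) (t : Fin (N σ)) =>
    exists_homotopy res (a σ t) d (hG _ (ha σ t)) (hGI ▸ Ideal.subset_span (ha σ t))
  have hone : ∀ (σ : Cht m) {ι : Type} (x : ι → Lr K m), ∑ t, r σ t • (phi A (a σ t) • x) = x := by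
    intro σ ι x
    simp only [smul_smul, ← Finset.sum_smul, hsum, one_smul]
  let T : Dat K m lam :=
    { Gen := fun i => GenT (res.β i)
      deg := fun i g => g.1
      D := fun i => bcL (phi A) (res.d i)
      H := fun σ i =>
        { toFun := fun x => ∑ t, r σ t • bc (phi A) (h σ t i) x
          map_add' := by
            intro x y
            simp only [← Finset.sum_add_distrib, ← smul_add]
            refine Finset.sum_congr rfl fun t _ => ?_
            congr 1
            exact map_add (bcL (K := K) (phi A) (h σ t i)) x y
          map_smul' := by
            intro c x
            rw [Finset.smul_sum]
            refine Finset.sum_congr rfl fun t _ => ?_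
            rw [RingHom.id_apply, smul_comm]
            congr 1
            exact map_smul (bcL (K := K) (phi A) (h σ t i)) c x }
      DD := by
        intro i x
        show bc (phi A) (res.d i) (bc (phi A) (res.d (i+1)) x) = 0
        rw [bc_comp, show res.d i ∘ₗ res.d (i+1) = 0 from LinearMap.ext fun x => d_comp res i x, bc_zero]
      DH0 := by
        intro σ x
        show bc (phi A) (res.d 0) (∑ t, r σ t • bc (phi A) (h σ t 0) x) = x
        rw [bc_smul_lin]
        conv_rhs => rw [← hone σ x]
        refine Finset.sum_congr rfl fun t _ => ?_
        rw [bc_comp, ← bc_smul_id]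
        congr 2
        exact LinearMap.ext fun x => hh2 σ t x
      DH := by
        intro σ i x
        show bc (phi A) (res.d (i+1)) (∑ t, r σ t • bc (phi A) (h σ t (i+1)) x) +
          ∑ t, r σ t • bc (phi A) (h σ t i) (bc (phi A) (res.d i) x) = x
        rw [bc_smul_lin, ← Finset.sum_add_distrib]
        conv_rhs => rw [← hone σ x]
        refine Finset.sum_congr rfl fun t _ => ?_
        rw [← smul_add, bc_comp, bc_comp, ← bc_add, ← bc_smul_id]
        congr 2
        exact LinearMap.ext fun x => hh3 σ t i x
      Dbox := by
        intro σ i x hx g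
        have := bc_box σ A (res.d i) (fun g => g.1) (fun g => g.1) 0 lam
          (fun g g' => by rw [add_zero]; exact d_hom res i g g') x hx g
        refine box_congr ?_ this
        intro l _; simp
      Hbox := by
        intro σ i x hx g
        show (∑ t, r σ t • bc (phi A) (h σ t i) x) g ∈ _
        rw [Finset.sum_apply]
        refine Submodule.sum_mem _ fun t _ => ?_
        have := mul_mem_box (hr σ t) (bc_box σ A (h σ t i) (fun g => g.1) (fun g => g.1) d lam
          (hh1 σ t i) x hx g)
        refine box_congr ?_ this
        intro l _; simp only [Pi.add_apply]; ring
      hdeg := by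
        intro i hi g l hl
        exact hdeg i hi g.1 (by have := g.2.2; omega) l hl }
  exact T.count hlam (⟨0, ⟨0, Nat.pos_of_ne_zero h0⟩⟩ : GenT (res.β 0)) rfl

end
end BCLB
namespace BCLB
open Function

section
variable {k : Type} [Field k] {n : ℕ} {I : Ideal (MvPolynomial (Fin n) k)}

theorem card_gen (res : Res I) (i : ℕ) : Fintype.card (GenT (res.β i)) = res.tB i := by
  have : (Finset.univ : Finset (GenT (res.β i))) = (res.finβ i).toFinset.sigma fun j => Finset.univ := by
    ext g
    simp only [Finset.mem_univ, Finset.mem_sigma, Set.Finite.mem_toFinset, mem_support, and_true, true_iff]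
    have := g.2.2; omega
  unfold MinGradedFreeRes.tB
  rw [← Finset.card_univ, this, Finset.card_sigma]
  simp

theorem column (res : Res I) (i : ℕ) (j : ℤ) (h : res.β (i+1) j ≠ 0) : ∃ j' < j, res.β i j' ≠ 0 := by
  let g : GenT (res.β (i+1)) := ⟨j, ⟨0, Nat.pos_of_ne_zero h⟩⟩
  by_cases hx : res.d i (Finsupp.single g 1) = 0
  · exfalso
    have h1 : Finsupp.single g 1 ∈ LinearMap.range (res.d (i+1)) := by
      rw [res.exact i]; exact hx
    obtain ⟨y, hy⟩ := h1
    have h2 := DFunLike.congr_fun hy g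
    rw [lin_expand, Finsupp.single_eq_same] at h2
    have h3 := congrArg MvPolynomial.constantCoeff h2
    rw [map_sum, map_one] at h3
    rw [Finset.sum_eq_zero] at h3
    · exact zero_ne_one h3
    · intro g' _
      rw [map_mul]
      by_cases hz : res.d (i+1) (Finsupp.single g' 1) g = 0
      · rw [hz]; simp
      · have hm : g.1 < g'.1 := res.minimal (i+1) g'.1 g'.2 g.1 g.2 hz
        rcases d_hom res (i+1) g' g with h0 | ⟨N, hN, hh⟩
        · exact absurd h0 hz
        · have : MvPolynomial.constantCoeff (res.d (i+1) (Finsupp.single g' 1) g) = 0 := by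
            rw [MvPolynomial.constantCoeff_eq]
            apply hh.coeff_eq_zero
            simp
            omega
          rw [this, mul_zero]
  · obtain ⟨g', hg'⟩ := Finsupp.ne_iff.1 hx
    exact ⟨g'.1, res.minimal i g.1 g.2 g'.1 g'.2 hg', by have := g'.2.2; omega⟩

theorem prod_shift (F : ℕ → ℚ) (m : ℕ) : ∏ l : Fin (m+1), F (l.val + 1) = F 1 * ∏ i ∈ Finset.Icc 2 (m+1), F i := by
  rw [Fin.prod_univ_eq_prod_range (fun i => F (i+1))]
  induction m with
  | zero => simp
  | succ m ih =>
    rw [Finset.prod_range_succ, ih, Finset.prod_Icc_succ_top (b := m + 1) (by omega), mul_assoc]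

theorem height_hyp (G : Set (MvPolynomial (Fin n) k)) (hGI : Ideal.span G = I) (c : ℕ)
    (hht : idealHeight I = (c : ℕ∞)) (P : Ideal (MvPolynomial (Fin n) k)) (hP : P.IsPrime) (hGP : G ⊆ P) :
    (c : ℕ∞) ≤ P.height := by
  rw [← hht]
  have h1 : I ≤ P := by rw [← hGI]; exact Ideal.span_le.2 hGP
  have h2 := PrimeSpectrum.height_eq_orderHeight (⟨P, hP⟩ : PrimeSpectrum (MvPolynomial (Fin n) k))
  rw [h2]
  exact iInf₂_le (⟨P, hP⟩ : PrimeSpectrum (MvPolynomial (Fin n) k)) h1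

theorem d_pos (G : Set (MvPolynomial (Fin n) k)) (hGI : Ideal.span G = I) (c : ℕ) (hc : 2 ≤ c)
    (hht : idealHeight I = (c : ℕ∞)) (d : ℕ) (hG : ∀ g ∈ G, g.IsHomogeneous d) : 1 ≤ d := by
  by_contra hd
  have hd : d = 0 := by omega
  subst hd
  by_cases hz : ∀ g ∈ G, g = 0
  · have := height_hyp G hGI c hht ⊥ Ideal.isPrime_bot (fun g hg => by simp [hz g hg])
    rw [Ideal.height_bot] at this
    have : c ≤ 0 := by exact_mod_cast this
    omega
  · push Not at hz
    obtain ⟨g, hg, hne⟩ := hz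
    have h1 : I = ⊤ := by
      rw [← hGI]
      apply Ideal.eq_top_of_isUnit_mem _ (Ideal.subset_span hg)
      have h2 := hG g hg
      have h3 : g.totalDegree = 0 := h2.totalDegree hne
      rw [MvPolynomial.totalDegree_eq_zero_iff_eq_C] at h3
      rw [h3] at hne ⊢
      refine (IsUnit.mk0 _ ?_).map MvPolynomial.C
      intro h0; apply hne; rw [h0, map_zero]
    have h2 : idealHeight I = ⊤ := by
      unfold idealHeight
      rw [iInf₂_eq_top]
      intro P hP
      exact absurd (top_le_iff.1 (h1 ▸ hP)) P.2.ne_top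
    rw [h2] at hht
    exact ENat.top_ne_natCast c hht

end
end BCLB

/-- Let `I ⊂ S = k[x₁,…,xₙ]` be a homogeneous ideal generated in degree
`d`, of height `c ≥ 2`; lower bound for `β_c(S/I)`. -/
theorem beta_c_lower_bound
    (k : Type) [Field k] (n : ℕ) (I : Ideal (MvPolynomial (Fin n) k)) (d : ℕ)
    (hgen : ∃ G : Set (MvPolynomial (Fin n) k),
      (∀ g ∈ G, MvPolynomial.IsHomogeneous g d) ∧ Ideal.span G = I)
    (res : MinGradedFreeRes (MvPolynomial (Fin n) k)
      (fun m => {f | MvPolynomial.IsHomogeneous f m})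
      (MvPolynomial (Fin n) k ⧸ I))
    (h0 : ∀ j : ℤ, res.β 0 j = if j = 0 then 1 else 0)
    (h1 : ∀ j : ℤ, res.β 1 j ≠ 0 → j = (d : ℤ))
    (p : ℕ) (hlen : ∀ i, p < i → res.β i = 0) (hp : res.β p ≠ 0)
    (c : ℕ) (hc : 2 ≤ c) (hht : idealHeight I = (c : ℕ∞))
    (ub lb : ℕ → ℤ)
    (hub : ∀ (i : ℕ) (j : ℤ), res.β i j ≠ 0 → j ≤ ub i)
    (hub' : ∀ i ≤ p, res.β i (ub i) ≠ 0)
    (hlb : ∀ (i : ℕ) (j : ℤ), res.β i j ≠ 0 → lb i ≤ j)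
    (hlb' : ∀ i ≤ p, res.β i (lb i) ≠ 0) :
    ((d : ℚ) * ∏ i ∈ Finset.Icc 2 (c - 1), (lb i : ℚ)) /
        (((ub c : ℚ) - (d : ℚ)) * ∏ i ∈ Finset.Icc 2 (c - 1), ((ub c : ℚ) - (lb i : ℚ)))
      ≤ (res.tB c : ℚ) := by
  obtain ⟨G, hG, hGI⟩ := hgen
  have hd := BCLB.d_pos G hGI c hc hht d hG
  have hh := BCLB.height_hyp G hGI c hht
  obtain ⟨m, rfl⟩ : ∃ m, c = m + 1 + 1 := ⟨c - 2, by omega⟩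
  have h00 : res.β 0 0 ≠ 0 := by rw [h0]; simp
  have hge : ∀ (i : ℕ) (j : ℤ), res.β i j ≠ 0 → (i : ℤ) ≤ j := by
    intro i
    induction i with
    | zero =>
      intro j hj
      rw [h0] at hj
      by_cases h : j = 0
      · simp [h]
      · simp [h] at hj
    | succ i ih =>
      intro j hj
      obtain ⟨j', hlt, hj'⟩ := BCLB.column res i j hj
      have := ih j' hj'
      push_cast; omega
  have hcp : m + 1 + 1 ≤ p := by
    by_contra hcon
    have hm := BCLB.main_ineq res G d hd hG hGI (m+1) hh h00 (fun l => (l.val : ℤ) + 1)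
      (by intro l; omega) (by
        intro i _ j hj l hl
        have := hge i j hj
        omega)
    have hz := hlen (m+1+1) (by omega)
    rw [Finset.sum_eq_zero] at hm
    · have : 0 < ∏ l : Fin (m+1), ((l.val : ℤ) + 1) := Finset.prod_pos fun l _ => by omega
      omega
    · intro g _
      have h2 := g.2.2
      have h3 : res.β (m+1+1) g.1 = 0 := congrFun hz g.1
      omega
  have hstep : ∀ i, i + 1 ≤ p → lb i < lb (i+1) := by
    intro i hi
    obtain ⟨j', hlt, hj'⟩ := BCLB.column res i _ (hlb' (i+1) hi)
    exact lt_of_le_of_lt (hlb i j' hj') hlt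
  have hmono : ∀ i t, i + t ≤ p → lb i + t ≤ lb (i + t) := by
    intro i t
    induction t with
    | zero => intro _; simp
    | succ t ih =>
      intro ht
      have a1 := ih (by omega)
      have a2 := hstep (i+t) (by omega)
      rw [← add_assoc]
      push_cast; omega
  have hlb1 : lb 1 = d := h1 _ (hlb' 1 (by omega))
  have hm := BCLB.main_ineq res G d hd hG hGI (m+1) hh h00 (fun l => lb (l.val + 1))
    (by
      intro l
      have := hge _ _ (hlb' (l.val+1) (by omega))
      push_cast at this; omega) (by
      intro i hi j hj l hl
      have a1 := hlb i j hj
      have a2 := hmono (l.val+1) (i - (l.val+1)) (by omega)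
      rw [Nat.add_sub_cancel' hl] at a2
      omega)
  have hlt : ∀ i, i < m + 1 + 1 → lb i < ub (m+1+1) := by
    intro i hi
    have a1 := hub _ _ (hlb' (m+1+1) hcp)
    have a2 := hmono i (m+1+1-i) (by omega)
    rw [Nat.add_sub_cancel' hi.le] at a2
    omega
  have hle : ∑ g : BCLB.GenT (res.β (m+1+1)), ∏ l : Fin (m+1), (g.1 - lb (l.val+1)) ≤
      (res.tB (m+1+1) : ℤ) * ∏ l : Fin (m+1), (ub (m+1+1) - lb (l.val+1)) := by
    rw [← BCLB.card_gen res, ← nsmul_eq_mul]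
    apply Finset.sum_le_card_nsmul
    intro g _
    have hg : res.β (m+1+1) g.1 ≠ 0 := by have := g.2.2; omega
    apply Finset.prod_le_prod
    · intro l _
      have a1 := hlb _ _ hg
      have a2 := hmono (l.val+1) (m+1+1 - (l.val+1)) (by omega)
      rw [Nat.add_sub_cancel' (by omega)] at a2
      omega
    · intro l _
      have := hub _ _ hg
      omega
  have hfin := hm.trans hle
  have hq : ((∏ l : Fin (m+1), lb (l.val+1) : ℤ) : ℚ) ≤
      ((res.tB (m+1+1) : ℤ) * ∏ l : Fin (m+1), (ub (m+1+1) - lb (l.val+1)) : ℤ) := by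
    exact_mod_cast hfin
  push_cast at hq
  rw [BCLB.prod_shift (fun i => (lb i : ℚ)),
    BCLB.prod_shift (fun i => (ub (m+1+1) : ℚ) - (lb i : ℚ)), hlb1] at hq
  simp only [Nat.add_sub_cancel]
  rw [div_le_iff₀]
  · exact_mod_cast hq
  · apply mul_pos
    · have := hlt 1 (by omega)
      rw [hlb1] at this
      have : ((d : ℤ) : ℚ) < ub (m+1+1) := by exact_mod_cast this
      push_cast at this
      linarith
    · apply Finset.prod_pos
      intro i hi
      rw [Finset.mem_Icc] at hi
      have := hlt i (by omega)
      have : ((lb i : ℤ) : ℚ) < ub (m+1+1) := by exact_mod_cast this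
      linarith
end
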